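/- Comparison principle and well-posedness for the penalized system: assume (H.1) and (H.2), and let ρ ≥ 0 be a fixed penalty parameter. If u^ρ is a bounded viscosity subsolution and v^ρ is a bounded viscosity supersolution of the penalized system with parameter ρ, then u^ρ_i ≤ v^ρ_i on ℝ^d for all i ∈ ℐ. Consequently, the penalized system admits a unique bounded viscosity solution, and there is a constant (independent of ρ) bounding the sup-norm of these solutions uniformly over all ρ ≥ 0. -/

import Mathlib

noncomputable section
open scoped BigOperators RealInnerProductSpace
open Filter Topology Matrix

namespace HJBQVI

abbrev E (d : ℕ) : Type := EuclideanSpace ℝ (Fin d)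

variable {d d' M : ℕ}

/-- Frobenius norm of a matrix. -/
def frobNorm (A : Matrix (Fin d) (Fin d') ℝ) : ℝ :=
  Real.sqrt (∑ k, ∑ l, (A k l) ^ 2)

/-- Hessian matrix of a real-valued function, via the second iterated Fréchet derivative. -/
def hess (φ : E d → ℝ) (x : E d) : Matrix (Fin d) (Fin d) ℝ :=
  Matrix.of fun i j =>
    iteratedFDeriv ℝ 2 φ x ![EuclideanSpace.single i (1 : ℝ), EuclideanSpace.single j (1 : ℝ)]

/-- Semiconcavity with constant `C`. -/
def Semiconcave (φ : E d → ℝ) (C : ℝ) : Prop :=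
  ∀ x h : E d, φ (x + h) - 2 * φ x + φ (x - h) ≤ C * ‖h‖ ^ 2

/-- Membership in `C⁰₁(ℝ^d)`: bounded, continuous, Lipschitz. -/
def InC01 (f : E d → ℝ) : Prop :=
  Continuous f ∧ (∃ C, ∀ x, |f x| ≤ C) ∧ ∃ L, ∀ x y, |f x - f y| ≤ L * ‖x - y‖

/-- Uniform boundedness of a system of functions. -/
def Bdd (u : Fin M → E d → ℝ) : Prop := ∃ C, ∀ i x, |u i x| ≤ C

/-- Coefficient data for the weakly coupled HJB operator. -/
structure HJBData (d d' M : ℕ) (𝒜 : Type) [MetricSpace 𝒜] where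
  A : Fin M → Set 𝒜
  σm : Fin M → 𝒜 → E d → Matrix (Fin d) (Fin d') ℝ
  bv : Fin M → 𝒜 → E d → E d
  cz : Fin M → 𝒜 → E d → ℝ
  runCost : Fin M → 𝒜 → E d → ℝ
  dcp : Fin M → Fin M → 𝒜 → E d → ℝ

variable {𝒜 𝒵 : Type} [MetricSpace 𝒜] [MetricSpace 𝒵]

/-- The linear operator `L^α_i(x, s, p, X)`. -/
def HJBData.L (P : HJBData d d' M 𝒜) (i : Fin M) (α : 𝒜) (x : E d)
    (s : Fin M → ℝ) (p : E d) (X : Matrix (Fin d) (Fin d) ℝ) : ℝ :=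
  - Matrix.trace (((1 : ℝ) / 2) • (P.σm i α x * (P.σm i α x)ᵀ) * X)
  - ⟪P.bv i α x, p⟫ + P.cz i α x * s i - P.runCost i α x
  - ∑ j ∈ Finset.univ.erase i, P.dcp i j α x * s j

/-- The Hamiltonian `sup_{α ∈ A_i} L^α_i`. -/
def HJBData.Ham (P : HJBData d d' M 𝒜) (i : Fin M) (x : E d)
    (s : Fin M → ℝ) (p : E d) (X : Matrix (Fin d) (Fin d) ℝ) : ℝ :=
  sSup ((fun α => P.L i α x s p X) '' P.A i)

/-- Data of the impulse intervention operator. -/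
structure ImpulseData (d M : ℕ) (𝒵 : Type) [MetricSpace 𝒵] where
  Z : Fin M → E d → Set 𝒵
  Γ : Fin M → E d → 𝒵 → E d
  K : Fin M → E d → 𝒵 → ℝ

/-- The intervention operator `(M_i u)(x) = min_{z ∈ Z_i(x)} [u_i(Γ_i(x,z)) + K_i(x,z)]`. -/
def ImpulseData.Mop (Q : ImpulseData d M 𝒵) (i : Fin M) (u : Fin M → E d → ℝ) (x : E d) : ℝ :=
  sInf ((fun z => u i (Q.Γ i x z) + Q.K i x z) '' Q.Z i x)

/-- Type of (possibly nonlocal) degenerate elliptic operators. -/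
abbrev Op (d M : ℕ) : Type :=
  Fin M → E d → (Fin M → E d → ℝ) → E d → Matrix (Fin d) (Fin d) ℝ → ℝ

/-- Viscosity subsolution (upper semicontinuous, tested from above by C² functions). -/
def IsSubsolution (F : Op d M) (u : Fin M → E d → ℝ) : Prop :=
  (∀ i, UpperSemicontinuous (u i)) ∧
  ∀ (i : Fin M) (φ : E d → ℝ), ContDiff ℝ 2 φ → ∀ x : E d,
    IsLocalMax (fun y => u i y - φ y) x → F i x u (gradient φ x) (hess φ x) ≤ 0

/-- Viscosity supersolution. -/
def IsSupersolution (F : Op d M) (u : Fin M → E d → ℝ) : Prop :=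
  (∀ i, LowerSemicontinuous (u i)) ∧
  ∀ (i : Fin M) (φ : E d → ℝ), ContDiff ℝ 2 φ → ∀ x : E d,
    IsLocalMin (fun y => u i y - φ y) x → 0 ≤ F i x u (gradient φ x) (hess φ x)

/-- Viscosity solution: continuous and both a sub- and a supersolution. -/
def IsSolution (F : Op d M) (u : Fin M → E d → ℝ) : Prop :=
  (∀ i, Continuous (u i)) ∧ IsSubsolution F u ∧ IsSupersolution F u

/-- Pure HJB operator. -/
def Fhjb (P : HJBData d d' M 𝒜) : Op d M :=
  fun i x u p X => P.Ham i x (fun j => u j x) p X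

/-- Obstacle problem operator with obstacle `Ψ`. -/
def Fob (P : HJBData d d' M 𝒜) (Ψ : Fin M → E d → ℝ) : Op d M :=
  fun i x u p X => max (P.Ham i x (fun j => u j x) p X) (u i x - Ψ i x)

/-- Penalized obstacle problem operator. -/
def FobPen (P : HJBData d d' M 𝒜) (Ψ : Fin M → E d → ℝ) (ρ : ℝ) : Op d M :=
  fun i x u p X => P.Ham i x (fun j => u j x) p X + ρ * max (u i x - Ψ i x) 0

/-- The HJBQVI operator. -/
def Fqvi (P : HJBData d d' M 𝒜) (Q : ImpulseData d M 𝒵) : Op d M :=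
  fun i x u p X => max (P.Ham i x (fun j => u j x) p X) (u i x - Q.Mop i u x)

/-- The penalized HJBQVI operator with penalty parameter `ρ`. -/
def Fpen (P : HJBData d d' M 𝒜) (Q : ImpulseData d M 𝒵) (ρ : ℝ) : Op d M :=
  fun i x u p X => P.Ham i x (fun j => u j x) p X + ρ * max (u i x - Q.Mop i u x) 0

/-- Assumption (H.1). -/
def H1 (P : HJBData d d' M 𝒜) (C lam0 : ℝ) : Prop :=
  0 < lam0 ∧
  (∀ i, (P.A i).Nonempty ∧ IsCompact (P.A i)) ∧
  ∀ i, ∀ α ∈ P.A i,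
    (∀ k l, Continuous fun x => P.σm i α x k l) ∧
    Continuous (P.bv i α) ∧ Continuous (P.cz i α) ∧ Continuous (P.runCost i α) ∧
    (∀ j, Continuous (P.dcp i j α)) ∧
    (∀ x, frobNorm (P.σm i α x) ≤ C) ∧
    (∀ x y, frobNorm (P.σm i α x - P.σm i α y) ≤ C * ‖x - y‖) ∧
    (∀ x, ‖P.bv i α x‖ ≤ C) ∧ (∀ x y, ‖P.bv i α x - P.bv i α y‖ ≤ C * ‖x - y‖) ∧
    (∀ x, |P.cz i α x| ≤ C) ∧ (∀ x y, |P.cz i α x - P.cz i α y| ≤ C * ‖x - y‖) ∧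
    (∀ x, |P.runCost i α x| ≤ C) ∧
    (∀ x y, |P.runCost i α x - P.runCost i α y| ≤ C * ‖x - y‖) ∧
    (∀ j, (∀ x, |P.dcp i j α x| ≤ C) ∧ ∀ x y, |P.dcp i j α x - P.dcp i j α y| ≤ C * ‖x - y‖) ∧
    (∀ j ∈ Finset.univ.erase i, ∀ x, 0 ≤ P.dcp i j α x) ∧
    ∀ x, lam0 ≤ P.cz i α x - ∑ j ∈ Finset.univ.erase i, P.dcp i j α x

/-- Assumption (H.2). -/
def H2 (Q : ImpulseData d M 𝒵) (κ₀ : ℝ) : Prop :=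
  0 < κ₀ ∧
  (∀ i x, (Q.Z i x).Nonempty ∧ IsCompact (Q.Z i x)) ∧
  (∀ i, Continuous fun p : E d × 𝒵 => Q.Γ i p.1 p.2) ∧
  (∀ i, Continuous fun p : E d × 𝒵 => Q.K i p.1 p.2) ∧
  (∀ (i : Fin M) (x : E d), ∀ ε > (0 : ℝ), ∃ δ > (0 : ℝ), ∀ y, dist y x < δ →
      Metric.hausdorffDist (Q.Z i x) (Q.Z i y) < ε) ∧
  ∀ i x, ∀ z ∈ Q.Z i x, κ₀ ≤ Q.K i x z

/-- Assumption (H.3): `λ₀ > sup_{i,α} ([σ^α_i]₁² + [b^α_i]₁)`. -/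
def H3 (P : HJBData d d' M 𝒜) (lam0 : ℝ) : Prop :=
  ∃ Kσ Kb : ℝ, 0 ≤ Kσ ∧ 0 ≤ Kb ∧ Kσ ^ 2 + Kb < lam0 ∧
    ∀ i, ∀ α ∈ P.A i,
      (∀ x y, frobNorm (P.σm i α x - P.σm i α y) ≤ Kσ * ‖x - y‖) ∧
      ∀ x y, ‖P.bv i α x - P.bv i α y‖ ≤ Kb * ‖x - y‖

/-- Assumption (H.4): the intervention operator preserves Lipschitz functions,
`[M_i u]₁ ≤ sup_j [u_j]₁ + C`. -/
def H4 (Q : ImpulseData d M 𝒵) (C : ℝ) : Prop :=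
  0 ≤ C ∧ ∀ u : Fin M → E d → ℝ, (∀ i, InC01 (u i)) →
    ∀ L : ℝ, 0 ≤ L → (∀ i x y, |u i x - u i y| ≤ L * ‖x - y‖) →
      ∀ i x y, |Q.Mop i u x - Q.Mop i u y| ≤ (L + C) * ‖x - y‖

/-- `C¹` regularity with bounded and Lipschitz derivative. -/
def C1Bound {F : Type} [NormedAddCommGroup F] [NormedSpace ℝ F] (f : E d → F) (C : ℝ) : Prop :=
  ContDiff ℝ 1 f ∧ (∀ x, ‖fderiv ℝ f x‖ ≤ C) ∧
    ∀ x y, ‖fderiv ℝ f x - fderiv ℝ f y‖ ≤ C * ‖x - y‖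

/-- Assumption (H.5). -/
def H5 (P : HJBData d d' M 𝒜) (C : ℝ) : Prop :=
  ∀ i, ∀ α ∈ P.A i,
    (∀ k l, C1Bound (fun x => P.σm i α x k l) C) ∧
    C1Bound (P.bv i α) C ∧ C1Bound (P.cz i α) C ∧
    (∀ j, C1Bound (P.dcp i j α) C) ∧
    Semiconcave (P.runCost i α) C

/-- Assumption (H.6): the intervention operator preserves semiconcave functions,
`[M_i u]_{2,+} ≤ sup_j [u_j]_{2,+} + C`. -/
def H6 (Q : ImpulseData d M 𝒵) (C : ℝ) : Prop :=
  0 ≤ C ∧ ∀ u : Fin M → E d → ℝ, (∀ i, Continuous (u i)) → (∃ B, ∀ i x, |u i x| ≤ B) →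
    ∀ Cu : ℝ, 0 ≤ Cu → (∀ i, Semiconcave (u i) Cu) →
      ∀ i, Semiconcave (fun x => Q.Mop i u x) (Cu + C)

/-- Switching intervention operator `(M_i u)(x) = min_{j ≠ i} [u_j(x) + k_{ij}(x)]`. -/
def Msw (k : Fin M → Fin M → E d → ℝ) (i : Fin M) (u : Fin M → E d → ℝ) (x : E d) : ℝ :=
  sInf ((fun j => u j x + k i j x) '' {j | j ≠ i})

/-- The switching HJBQVI operator. -/
def Fsw (P : HJBData d d' M 𝒜) (k : Fin M → Fin M → E d → ℝ) : Op d M :=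
  fun i x u p X => max (P.Ham i x (fun j => u j x) p X) (u i x - Msw k i u x)

/-- The componentwise penalized switching system operator. -/
def FswPen (P : HJBData d d' M 𝒜) (k : Fin M → Fin M → E d → ℝ) (ρ : ℝ) : Op d M :=
  fun i x u p X => P.Ham i x (fun j => u j x) p X
    + ρ * ∑ j ∈ Finset.univ.erase i, max (u i x - u j x - k i j x) 0

/-- Assumption (H.7) on signed switching costs. -/
def H7 (k : Fin M → Fin M → E d → ℝ) (κ₀ C : ℝ) : Prop :=
  0 < κ₀ ∧ 0 ≤ C ∧
  (∀ i x, k i i x = 0) ∧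
  (∀ i j l, j ≠ i → ∀ x : E d, κ₀ ≤ k i j x + k j l x - k i l x) ∧
  (∀ i j, (∀ x, |k i j x| ≤ C) ∧ ∀ x y, |k i j x - k i j y| ≤ C * ‖x - y‖) ∧
  ∀ i j (x : E d), k i j x < κ₀ → ∃ h₀ > (0 : ℝ), ∀ h : E d, ‖h‖ < h₀ →
    k i j (x + h) - 2 * k i j x + k i j (x - h) ≤ C * ‖h‖ ^ 2

/-- `k̃_i = min{min_{j≠i}(k_{ji} − ε), 0}`. -/
def ktil (k : Fin M → Fin M → E d → ℝ) (ε : ℝ) (i : Fin M) (x : E d) : ℝ :=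
  sInf (insert 0 ((fun j => k j i x - ε) '' {j | j ≠ i}))

/-- Strict viscosity subsolution with margin `g`: `F_i(x, u, Dφ, D²φ) ≤ g` at
every local maximum of `u_i − φ`. -/
def IsStrictSubsolution (F : Op d M) (g : ℝ) (u : Fin M → E d → ℝ) : Prop :=
  (∀ i, UpperSemicontinuous (u i)) ∧
  ∀ (i : Fin M) (φ : E d → ℝ), ContDiff ℝ 2 φ → ∀ x : E d,
    IsLocalMax (fun y => u i y - φ y) x → F i x u (gradient φ x) (hess φ x) ≤ g

/-- Half-relaxed upper limit `u*(x) = limsup_{ρ→∞, y→x} u^ρ(y)`. -/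
def relaxSup (u : ℕ → E d → ℝ) (x : E d) : ℝ :=
  Filter.limsup (fun p : ℕ × E d => u p.1 p.2) (Filter.atTop ×ˢ nhds x)

/-- Half-relaxed lower limit `u_*(x) = liminf_{ρ→∞, y→x} u^ρ(y)`. -/
def relaxInf (u : ℕ → E d → ℝ) (x : E d) : ℝ :=
  Filter.liminf (fun p : ℕ × E d => u p.1 p.2) (Filter.atTop ×ˢ nhds x)

/-- Set of optimal impulse controls `𝒵^v_i(x)`. -/
def argminSet (Q : ImpulseData d M 𝒵) (v : Fin M → E d → ℝ) (i : Fin M) (x : E d) : Set 𝒵 :=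
  {z | z ∈ Q.Z i x ∧ ∀ z' ∈ Q.Z i x,
    v i (Q.Γ i x z) + Q.K i x z ≤ v i (Q.Γ i x z') + Q.K i x z'}


section Regularization

variable {V : Type*} [NormedAddCommGroup V] [InnerProductSpace ℝ V]

/-- An upper semicontinuous function dominated outside a ball by one of its values attains its
maximum. -/
lemma exists_forall_le_of_upperSemicontinuous {W : Type*} [NormedAddCommGroup W] [ProperSpace W]
    {f : W → ℝ} (hf : UpperSemicontinuous f) (x₀ : W) (R : ℝ)
    (hR : ∀ x, R < ‖x‖ → f x ≤ f x₀) : ∃ x, ∀ y, f y ≤ f x := by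
  obtain ⟨a, -, ha⟩ := UpperSemicontinuousOn.exists_isMaxOn
    (s := Metric.closedBall (0 : W) (max R ‖x₀‖)) ⟨x₀, by simp⟩
    (isCompact_closedBall _ _) (hf.upperSemicontinuousOn _)
  refine ⟨a, fun y => ?_⟩
  rcases le_or_gt ‖y‖ (max R ‖x₀‖) with h | h
  · exact ha (by simpa using h)
  · exact (hR y ((le_max_left _ _).trans_lt h)).trans (ha (by simp))

/-- Sup-convolution of a bounded upper semicontinuous function with a paraboloid. -/
lemma exists_supConvolution [FiniteDimensional ℝ V] {u : V → ℝ} (hu : UpperSemicontinuous u)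
    {B : ℝ} (hB : ∀ x, |u x| ≤ B) {k : ℝ} (hk : 0 < k) :
    ∃ U : V → ℝ, (∀ y s, u s - k * ‖y - s‖ ^ 2 ≤ U y) ∧
      ∀ y, ∃ s, U y = u s - k * ‖y - s‖ ^ 2 := by
  have : ProperSpace V := FiniteDimensional.proper ℝ V
  have key : ∀ y : V, ∃ s, ∀ s', u s' - k * ‖y - s'‖ ^ 2 ≤ u s - k * ‖y - s‖ ^ 2 := by
    intro y
    have hsc : UpperSemicontinuous fun s => u s + -(k * ‖y - s‖ ^ 2) :=
      hu.add (Continuous.upperSemicontinuous (by fun_prop))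
    obtain ⟨s, hs⟩ := exists_forall_le_of_upperSemicontinuous hsc y (‖y‖ + (2 * B / k + 1)) (by
      intro s hs
      have h1 : 2 * B / k + 1 < ‖y - s‖ := by
        have := norm_sub_norm_le s y
        rw [norm_sub_rev] at this
        linarith
      have hB0 : 0 ≤ B := (abs_nonneg _).trans (hB 0)
      have h0 : 0 ≤ 2 * B / k := by positivity
      have h2 : 2 * B / k ≤ ‖y - s‖ ^ 2 := by nlinarith
      have h3 : 2 * B ≤ k * ‖y - s‖ ^ 2 := by
        rw [div_le_iff₀ hk] at h2
        linarith
      have := abs_le.1 (hB s)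
      have := abs_le.1 (hB y)
      simp only [sub_self, norm_zero]
      nlinarith)
    exact ⟨s, fun s' => by simpa [sub_eq_add_neg] using hs s'⟩
  choose S hS using key
  exact ⟨fun y => u (S y) - k * ‖y - S y‖ ^ 2, fun y s => hS y s, fun y => ⟨S y, rfl⟩⟩

lemma lowerSemicontinuous_of_touching {W : Type*} [NormedAddCommGroup W] {U u : W → ℝ} {k : ℝ}
    (h₁ : ∀ y s, u s - k * ‖y - s‖ ^ 2 ≤ U y) (h₂ : ∀ y, ∃ s, U y = u s - k * ‖y - s‖ ^ 2) :
    LowerSemicontinuous U := by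
  intro y c hc
  obtain ⟨s, hs⟩ := h₂ y
  have hcont : Continuous fun y' => u s - k * ‖y' - s‖ ^ 2 := by fun_prop
  filter_upwards [hcont.continuousAt.eventually_const_lt (u := c) (v := u s - k * ‖y - s‖ ^ 2)
    (by rw [← hs]; exact hc)] with y' hy'
  exact hy'.trans_le (h₁ y' s)

lemma eq_of_inner_le_sq {p q : V} {c : ℝ} (h : ∀ e : V, ⟪p, e⟫ ≤ ⟪q, e⟫ + c * ‖e‖ ^ 2) :
    p = q := by
  by_contra hne
  have hpos : 0 < ‖p - q‖ ^ 2 := by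
    have := norm_pos_iff.2 (sub_ne_zero.2 hne)
    positivity
  have ht : 0 < 1 / (|c| + 1) := by positivity
  have h1 := h ((1 / (|c| + 1)) • (p - q))
  have h2 : ⟪p, (1 / (|c| + 1)) • (p - q)⟫ - ⟪q, (1 / (|c| + 1)) • (p - q)⟫
      = (1 / (|c| + 1)) * ‖p - q‖ ^ 2 := by
    rw [← inner_sub_left, inner_smul_right, real_inner_self_eq_norm_sq]
  rw [norm_smul, mul_pow, Real.norm_of_nonneg ht.le] at h1
  have h3 : (1 / (|c| + 1)) * ‖p - q‖ ^ 2 ≤ c * ((1 / (|c| + 1)) ^ 2 * ‖p - q‖ ^ 2) := by linarith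
  have h4 : (1 / (|c| + 1)) ≤ c * (1 / (|c| + 1)) ^ 2 := by
    have : (1 / (|c| + 1)) * ‖p - q‖ ^ 2 ≤ (c * (1 / (|c| + 1)) ^ 2) * ‖p - q‖ ^ 2 := by linarith
    exact le_of_mul_le_mul_right this hpos
  have h5 : 1 ≤ c * (1 / (|c| + 1)) := by
    rw [sq, ← mul_assoc] at h4
    exact le_of_mul_le_mul_right (by linarith) ht
  rw [mul_one_div, le_div_iff₀ (by positivity)] at h5
  linarith [le_abs_self c]

/-- A bounded upper semicontinuous function has a `C^{1,1}` majorant which coincides with its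
sup-convolution wherever it can be touched from above by a paraboloid of small opening. -/
lemma exists_c11_majorant [FiniteDimensional ℝ V] {u : V → ℝ} (hu : UpperSemicontinuous u)
    {B : ℝ} (hB : ∀ x, |u x| ≤ B) {k : ℝ} (hk : 0 < k) :
    ∃ (g : V → ℝ) (G : V → V),
      (∀ x s, u s - k * ‖x - s‖ ^ 2 ≤ g x) ∧
      (∀ x, g x ≤ B) ∧
      (∀ x h, |g (x + h) - g x - ⟪G x, h⟫| ≤ 3 * k * ‖h‖ ^ 2) ∧
      ∀ (x p : V) (κ : ℝ), κ < k → (∀ h, g (x + h) ≤ g x + ⟪p, h⟫ + κ * ‖h‖ ^ 2) →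
        ∃ s, g x = u s - k * ‖x - s‖ ^ 2 := by
  obtain ⟨U, hU1, hU2⟩ := exists_supConvolution hu hB (half_pos hk)
  have hUl := lowerSemicontinuous_of_touching hU1 hU2
  have hUB : ∀ y, |U y| ≤ B := by
    intro y
    obtain ⟨s, hs⟩ := hU2 y
    have h1 := hU1 y y
    rw [sub_self, norm_zero] at h1
    have := abs_le.1 (hB y)
    have := abs_le.1 (hB s)
    have : 0 ≤ k / 2 * ‖y - s‖ ^ 2 := by positivity
    rw [abs_le]; constructor <;> nlinarith
  obtain ⟨g', hg1', hg2'⟩ := exists_supConvolution (u := fun y => - U y) hUl.neg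
    (B := B) (by simpa using hUB) hk
  set g : V → ℝ := fun x => - g' x with hg
  have hg1 : ∀ x y, g x ≤ U y + k * ‖x - y‖ ^ 2 := fun x y => by
    have := hg1' x y
    simp only [hg]; linarith
  have hg2 : ∀ x, ∃ y, g x = U y + k * ‖x - y‖ ^ 2 := fun x => by
    obtain ⟨y, hy⟩ := hg2' x
    exact ⟨y, by simp only [hg]; linarith⟩
  choose Y hY using hg2
  have hlow : ∀ x s, u s - k * ‖x - s‖ ^ 2 ≤ g x := by
    intro x s
    rw [hY]
    have h1 := hU1 (Y x) s
    have h2 : ‖Y x - s‖ ^ 2 ≤ 2 * ‖x - s‖ ^ 2 + 2 * ‖x - Y x‖ ^ 2 := by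
      have h3 := parallelogram_law_with_norm ℝ (x - s) (x - Y x)
      have h4 : (x - s) - (x - Y x) = Y x - s := by abel
      rw [h4] at h3
      nlinarith [sq_nonneg ‖x - s + (x - Y x)‖]
    nlinarith
  have hupper : ∀ x h, g (x + h) ≤ g x + ⟪(2 * k) • (x - Y x), h⟫ + k * ‖h‖ ^ 2 := by
    intro x h
    have h1 := hg1 (x + h) (Y x)
    have h2 : x + h - Y x = (x - Y x) + h := by abel
    rw [h2, norm_add_sq_real] at h1
    rw [hY x, inner_smul_left]
    simp only [conj_trivial]
    linarith
  have hmid : ∀ x h, 2 * g x - 2 * k * ‖h‖ ^ 2 ≤ g (x + h) + g (x - h) := by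
    intro x h
    set a := Y (x + h) with ha
    set b := Y (x - h) with hb
    set y := (2 : ℝ)⁻¹ • (a + b) with hy
    set l := (2 : ℝ)⁻¹ • (a - b) with hl
    have hay : a = y + l := by
      rw [hy, hl, ← smul_add]; rw [show a + b + (a - b) = (2 : ℝ) • a by rw [two_smul]; abel]
      rw [smul_smul]; norm_num
    have hby : b = y - l := by
      rw [hy, hl, ← smul_sub]; rw [show a + b - (a - b) = (2 : ℝ) • b by rw [two_smul]; abel]
      rw [smul_smul]; norm_num
    rw [hY (x + h), hY (x - h), ← ha, ← hb, hay, hby]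
    obtain ⟨t, ht⟩ := hU2 y
    have e1 := hU1 (y + l) t
    have e2 := hU1 (y - l) t
    have e3 := hg1 x y
    rw [show y + l - t = (y - t) + l by abel, norm_add_sq_real] at e1
    rw [show y - l - t = (y - t) - l by abel, norm_sub_sq_real] at e2
    rw [show x + h - (y + l) = (x - y) + (h - l) by abel, norm_add_sq_real (x - y) (h - l),
      show x - h - (y - l) = (x - y) - (h - l) by abel, norm_sub_sq_real (x - y) (h - l)]
    have e4 : ‖l‖ ^ 2 ≤ 2 * ‖h - l‖ ^ 2 + 2 * ‖h‖ ^ 2 := by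
      have h3 := parallelogram_law_with_norm ℝ (h - l) h
      rw [show h - l - h = -l by abel, norm_neg] at h3
      nlinarith [sq_nonneg ‖h - l + h‖]
    nlinarith
  refine ⟨g, fun x => (2 * k) • (x - Y x), hlow, ?_, ?_, ?_⟩
  · intro x
    have := hg1 x x
    rw [sub_self, norm_zero] at this
    have := abs_le.1 (hUB x)
    linarith
  · intro x h
    rw [abs_le]
    have h1 := hupper x h
    have h2 := hupper x (-h)
    have h3 := hmid x h
    rw [norm_neg, inner_neg_right, ← sub_eq_add_neg] at h2
    have : 0 ≤ k * ‖h‖ ^ 2 := by positivity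
    constructor <;> nlinarith
  · intro x p κ hκ hp
    obtain ⟨s, hs⟩ := hU2 (Y x)
    have hpG : p = (2 * k) • (x - Y x) := by
      symm
      refine eq_of_inner_le_sq (c := 2 * k + k + κ) fun e => ?_
      have h1 := hp e
      have h2 := hupper x (-e)
      have h3 := hmid x e
      rw [norm_neg, inner_neg_right, ← sub_eq_add_neg] at h2
      linarith
    set t := (2 : ℝ)⁻¹ • (Y x + s) with ht
    have hts : t - s = (2 : ℝ)⁻¹ • (Y x - s) := by
      rw [ht]; module
    have htY : t - Y x = - ((2 : ℝ)⁻¹ • (Y x - s)) := by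
      rw [ht]; module
    have h1 := hlow t s
    have h2 := hp (t - x)
    rw [add_sub_cancel] at h2
    have hz : ‖t - x‖ ^ 2 ≤ 0 := by
      have e1 : k * ‖t - Y x‖ ^ 2 = k * ‖x - Y x‖ ^ 2 + ⟪p, t - x⟫ + k * ‖t - x‖ ^ 2 := by
        rw [show t - Y x = (x - Y x) + (t - x) by abel, norm_add_sq_real, hpG, inner_smul_left]
        simp only [conj_trivial]
        ring
      have e2 : ‖t - s‖ ^ 2 = 1 / 4 * ‖Y x - s‖ ^ 2 := by
        rw [hts, norm_smul, mul_pow]; norm_num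
      have e3 : ‖t - Y x‖ ^ 2 = 1 / 4 * ‖Y x - s‖ ^ 2 := by
        rw [htY, norm_neg, norm_smul, mul_pow]; norm_num
      rw [hY x, hs] at h2
      rw [e2] at h1
      rw [e3] at e1
      have : (k - κ) * ‖t - x‖ ^ 2 ≤ 0 := by nlinarith
      by_contra hcon
      push Not at hcon
      nlinarith
    have htx : t = x := by
      have : ‖t - x‖ = 0 := by
        have := sq_nonneg ‖t - x‖
        exact pow_eq_zero_iff (two_ne_zero) |>.1 (le_antisymm hz this)
      exact sub_eq_zero.1 (norm_eq_zero.1 this)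
    refine ⟨s, ?_⟩
    have e1 : x - Y x = -((2 : ℝ)⁻¹ • (Y x - s)) := by rw [← htY, htx]
    have e2 : x - s = (2 : ℝ)⁻¹ • (Y x - s) := by rw [← hts, htx]
    rw [hY x, hs, e1, e2, norm_neg, norm_smul, mul_pow]
    norm_num
    ring

end Regularization

section SecondOrder

variable {V : Type*} [NormedAddCommGroup V] [InnerProductSpace ℝ V]

lemma hasFDerivAt_of_abs_sub_inner_le {g : V → ℝ} {G : V → V} {c : ℝ}
    (h : ∀ x h, |g (x + h) - g x - ⟪G x, h⟫| ≤ c * ‖h‖ ^ 2) (x : V) :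
    HasFDerivAt g (innerSL ℝ (G x)) x := by
  rw [hasFDerivAt_iff_isLittleO_nhds_zero]
  refine Asymptotics.IsBigO.trans_isLittleO (g := fun h : V => ‖h‖ ^ 2) ?_
    (Asymptotics.isLittleO_norm_pow_id one_lt_two)
  refine Asymptotics.IsBigO.of_bound c (Eventually.of_forall fun e => ?_)
  simpa using h x e

lemma lipschitzWith_of_abs_sub_inner_le {g : V → ℝ} {G : V → V} {c : ℝ} (hc : 0 ≤ c)
    (h : ∀ x h, |g (x + h) - g x - ⟪G x, h⟫| ≤ c * ‖h‖ ^ 2) :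
    LipschitzWith (Real.toNNReal (6 * c)) G := by
  refine LipschitzWith.of_dist_le_mul fun x y => ?_
  rw [Real.coe_toNNReal _ (by positivity), dist_eq_norm, dist_eq_norm]
  rcases eq_or_ne (G x) (G y) with he | he
  · rw [he, sub_self, norm_zero]; positivity
  have hpos : 0 < ‖G x - G y‖ := norm_pos_iff.2 (sub_ne_zero.2 he)
  set e : V := (‖x - y‖ / ‖G x - G y‖) • (G x - G y) with hedef
  have hen : ‖e‖ = ‖x - y‖ := by
    rw [hedef, norm_smul, norm_div, norm_norm, norm_norm, div_mul_cancel₀ _ hpos.ne']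
  have hinner : ⟪G x - G y, e⟫ = ‖x - y‖ * ‖G x - G y‖ := by
    rw [hedef, inner_smul_right, real_inner_self_eq_norm_sq]
    field_simp
  have h1 := abs_le.1 (h x ((y - x) + e))
  have h2 := abs_le.1 (h x (y - x))
  have h3 := abs_le.1 (h y e)
  rw [show x + ((y - x) + e) = y + e by abel, inner_add_right] at h1
  rw [show x + (y - x) = y by abel] at h2
  have h4 : ‖(y - x) + e‖ ^ 2 ≤ 4 * ‖x - y‖ ^ 2 := by
    have := norm_add_le (y - x) e
    rw [hen, norm_sub_rev] at this
    nlinarith [norm_nonneg (y - x + e), norm_nonneg (x - y)]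
  rw [norm_sub_rev] at h2
  rw [hen] at h3
  rw [inner_sub_left] at hinner
  have h5 : ‖x - y‖ * ‖G x - G y‖ ≤ ‖x - y‖ * (6 * c * ‖x - y‖) := by
    nlinarith
  rcases eq_or_lt_of_le (norm_nonneg (x - y)) with h0 | h0
  · rw [eq_comm, norm_eq_zero, sub_eq_zero] at h0
    exact absurd (by rw [h0]) he
  · exact le_of_mul_le_mul_left h5 h0

/-- Second-order Taylor expansion at a point of differentiability of the gradient. -/
lemma eventually_taylor_two {g : V → ℝ} {G : V → V}
    (hg : ∀ x, HasFDerivAt g (innerSL ℝ (G x)) x) {x : V} {A : V →L[ℝ] V}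
    (hA : HasFDerivAt G A x) {η : ℝ} (hη : 0 < η) :
    ∀ᶠ h in 𝓝 (0 : V), |g (x + h) - g x - ⟪G x, h⟫ - 1 / 2 * ⟪A h, h⟫| ≤ η * ‖h‖ ^ 2 := by
  have h1 := (hasFDerivAt_iff_isLittleO_nhds_zero.1 hA).bound hη
  obtain ⟨r, hr, hball⟩ := Metric.eventually_nhds_iff.1 h1
  filter_upwards [Metric.ball_mem_nhds (0 : V) hr] with h hh
  have hh' : ‖h‖ < r := by simpa using hh
  set ψ : ℝ → ℝ := fun t => g (x + t • h) - t * ⟪G x, h⟫ - t ^ 2 * (1 / 2 * ⟪A h, h⟫) with hψ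
  have hder : ∀ t : ℝ, HasDerivAt ψ (⟪G (x + t • h), h⟫ - ⟪G x, h⟫ - t * ⟪A h, h⟫) t := by
    intro t
    have e1 : HasDerivAt (fun t : ℝ => x + t • h) h t := by
      simpa using ((hasDerivAt_id t).smul_const h).const_add x
    have e2 := (hg (x + t • h)).comp_hasDerivAt t e1
    have e3 := (hasDerivAt_id t).mul_const ⟪G x, h⟫
    have e4 := (hasDerivAt_pow 2 t).mul_const (1 / 2 * ⟪A h, h⟫)
    refine ((e2.sub e3).sub e4).congr_deriv ?_
    simp only [innerSL_apply_apply]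
    norm_num
    ring
  have hbound := norm_image_sub_le_of_norm_deriv_le_segment_01' (f := ψ)
    (f' := fun t => ⟪G (x + t • h), h⟫ - ⟪G x, h⟫ - t * ⟪A h, h⟫) (C := η * ‖h‖ ^ 2)
    (fun t _ => (hder t).hasDerivWithinAt) (by
      intro t ht
      have ht1 : ‖t • h‖ ≤ ‖h‖ := by
        rw [norm_smul, Real.norm_of_nonneg ht.1]
        exact mul_le_of_le_one_left (norm_nonneg _) ht.2.le
      have e := hball (y := t • h) (by rw [dist_zero_right]; linarith)
      have : ⟪G (x + t • h), h⟫ - ⟪G x, h⟫ - t * ⟪A h, h⟫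
          = ⟪G (x + t • h) - G x - A (t • h), h⟫ := by
        rw [inner_sub_left, inner_sub_left, map_smul, inner_smul_left]; simp
      rw [this]
      calc _ ≤ ‖G (x + t • h) - G x - A (t • h)‖ * ‖h‖ := norm_inner_le_norm _ _
        _ ≤ (η * ‖h‖) * ‖h‖ := by
          gcongr
          exact e.trans (by gcongr)
        _ = η * ‖h‖ ^ 2 := by ring)
  rw [Real.norm_eq_abs] at hbound
  convert hbound using 2
  simp only [hψ]
  simp
  ring

/-- Almost every small vector is a value that a Lipschitz map takes only at points of
differentiability. -/
lemma exists_regular_value {W : Type*} [NormedAddCommGroup W] [NormedSpace ℝ W]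
    [FiniteDimensional ℝ W] {T : W → W} {K : NNReal} (hT : LipschitzWith K T) {η : ℝ}
    (hη : 0 < η) : ∃ p, ‖p‖ < η ∧ ∀ z, T z = p → DifferentiableAt ℝ T z := by
  borelize W
  have : ProperSpace W := FiniteDimensional.proper ℝ W
  let μ : MeasureTheory.Measure W := MeasureTheory.Measure.hausdorffMeasure (Module.finrank ℝ W)
  have : μ.IsAddHaarMeasure := MeasureTheory.isAddHaarMeasure_hausdorffMeasure
  have h0 : μ {z | ¬ DifferentiableAt ℝ T z} = 0 := hT.ae_differentiableAt
  have h1 : μ (T '' {z | ¬ DifferentiableAt ℝ T z}) = 0 := by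
    have := hT.hausdorffMeasure_image_le (d := (Module.finrank ℝ W : ℝ)) (by positivity)
      {z | ¬ DifferentiableAt ℝ T z}
    change μ _ ≤ _ * μ _ at this
    rw [h0, mul_zero] at this
    exact le_antisymm this bot_le
  by_contra! hcon
  have h2 : Metric.ball (0 : W) η ⊆ T '' {z | ¬ DifferentiableAt ℝ T z} := by
    intro p hp
    obtain ⟨z, hz, hz'⟩ := hcon p (by simpa using hp)
    exact ⟨z, hz', hz⟩
  exact (Metric.measure_ball_pos μ (0 : W) hη).ne' (MeasureTheory.measure_mono_null h2 h1)

end SecondOrder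

section Doubling

variable {V : Type*} [NormedAddCommGroup V] [InnerProductSpace ℝ V]

/-- `(p, A)` is a second-order superjet of `u` at `s`. -/
def IsSuperjet (u : V → ℝ) (s p : V) (A : V →L[ℝ] V) : Prop :=
  ∀ η > 0, ∀ᶠ h in 𝓝 (0 : V), u (s + h) ≤ u s + ⟪p, h⟫ + 1 / 2 * ⟪A h, h⟫ + η * ‖h‖ ^ 2

/-- Doubling function of the maximum principle for semicontinuous functions. -/
def doublingPenalty (N β : ℝ) (x₀ x y : V) : ℝ :=
  N * ‖x - y‖ ^ 2 + β * ‖x‖ ^ 2 + β * ‖x - x₀‖ ^ 2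

lemma doublingPenalty_add (N β : ℝ) (x₀ x y ξ ζ : V) :
    doublingPenalty N β x₀ (x + ξ) (y + ζ) = doublingPenalty N β x₀ x y
      + ⟪(2 * N) • (x - y) + (2 * β) • x + (2 * β) • (x - x₀), ξ⟫ - ⟪(2 * N) • (x - y), ζ⟫
      + N * ‖ξ - ζ‖ ^ 2 + 2 * β * ‖ξ‖ ^ 2 := by
  unfold doublingPenalty
  rw [show x + ξ - (y + ζ) = (x - y) + (ξ - ζ) by abel,
    show x + ξ - x₀ = (x - x₀) + ξ by abel, norm_add_sq_real (x - y) (ξ - ζ),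
    norm_add_sq_real x ξ, norm_add_sq_real (x - x₀) ξ, inner_sub_right]
  simp only [inner_add_left, inner_smul_left, conj_trivial]
  ring

lemma isSuperjet_of_majorant {u g : V → ℝ} {G : V → V} {k : ℝ}
    (hlow : ∀ x s, u s - k * ‖x - s‖ ^ 2 ≤ g x)
    (hg : ∀ x, HasFDerivAt g (innerSL ℝ (G x)) x) {x s : V} {A : V →L[ℝ] V}
    (hA : HasFDerivAt G A x) (hs : g x = u s - k * ‖x - s‖ ^ 2) :
    IsSuperjet u s (G x) A := by
  intro η hη
  filter_upwards [eventually_taylor_two hg hA hη] with h hh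
  have h1 := (abs_le.1 hh).2
  have h2 := hlow (x + h) (s + h)
  rw [show x + h - (s + h) = x - s by abel] at h2
  linarith

lemma inner_add_inner_le_of_isMax {g₁ g₂ : V → ℝ} {G₁ G₂ : V → V}
    (hg₁ : ∀ x, HasFDerivAt g₁ (innerSL ℝ (G₁ x)) x)
    (hg₂ : ∀ x, HasFDerivAt g₂ (innerSL ℝ (G₂ x)) x) {x y : V} {A₁ A₂ : V →L[ℝ] V}
    (hA₁ : HasFDerivAt G₁ A₁ x) (hA₂ : HasFDerivAt G₂ A₂ y) {N β : ℝ}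
    (hmax : ∀ ξ ζ, g₁ (x + ξ) + g₂ (y + ζ) ≤ g₁ x + g₂ y + ⟪G₁ x, ξ⟫ + ⟪G₂ y, ζ⟫
      + N * ‖ξ - ζ‖ ^ 2 + 2 * β * ‖ξ‖ ^ 2) (ξ ζ : V) :
    ⟪A₁ ξ, ξ⟫ + ⟪A₂ ζ, ζ⟫ ≤ 2 * N * ‖ξ - ζ‖ ^ 2 + 4 * β * ‖ξ‖ ^ 2 := by
  refine le_of_forall_pos_le_add fun ε hε => ?_
  set η : ℝ := ε / (2 * (‖ξ‖ ^ 2 + ‖ζ‖ ^ 2 + 1)) with hη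
  have hη0 : 0 < η := by positivity
  have hcont : ∀ v : V, Tendsto (fun t : ℝ => t • v) (𝓝[>] 0) (𝓝 0) := fun v => by
    have : Continuous fun t : ℝ => t • v := by fun_prop
    have h := this.tendsto 0
    rw [zero_smul] at h
    exact h.mono_left nhdsWithin_le_nhds
  have e1 := (hcont ξ).eventually (eventually_taylor_two hg₁ hA₁ hη0)
  have e2 := (hcont ζ).eventually (eventually_taylor_two hg₂ hA₂ hη0)
  obtain ⟨t, h1, h2, ht⟩ := (e1.and (e2.and self_mem_nhdsWithin)).exists
  have ht' : 0 < t := ht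
  have h3 := hmax (t • ξ) (t • ζ)
  rw [← smul_sub] at h3
  have h1' := (abs_le.1 h1).1
  have h2' := (abs_le.1 h2).1
  simp only [map_smul, inner_smul_left, inner_smul_right, conj_trivial, norm_smul, mul_pow,
    Real.norm_of_nonneg ht'.le] at h1' h2' h3
  have h4 : t ^ 2 * (⟪A₁ ξ, ξ⟫ + ⟪A₂ ζ, ζ⟫) ≤
      t ^ 2 * (2 * N * ‖ξ - ζ‖ ^ 2 + 4 * β * ‖ξ‖ ^ 2 + 2 * η * (‖ξ‖ ^ 2 + ‖ζ‖ ^ 2)) := by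
    nlinarith
  have h5 := le_of_mul_le_mul_left h4 (by positivity)
  have h6 : 2 * η * (‖ξ‖ ^ 2 + ‖ζ‖ ^ 2) ≤ ε := by
    have : 2 * η * (‖ξ‖ ^ 2 + ‖ζ‖ ^ 2 + 1) = ε := by rw [hη]; field_simp
    nlinarith
  linarith

set_option maxHeartbeats 1600000 in
/-- Approximate theorem on sums: near-maximal points of the doubled function carrying
superjets ordered by the Hessian of the penalty. -/
lemma exists_doubling_point [FiniteDimensional ℝ V] {u w : V → ℝ}
    (hu : UpperSemicontinuous u) (hw : UpperSemicontinuous w) {B : ℝ}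
    (hBu : ∀ x, |u x| ≤ B) (hBw : ∀ x, |w x| ≤ B) {N β k η : ℝ} (hN : 0 < N) (hβ : 0 < β)
    (hk : N + 2 * β < k) (hη : 0 < η) (x₀ : V) :
    ∃ (x y s t p q : V) (A₁ A₂ : V →L[ℝ] V), ‖p‖ ≤ η ∧ ‖q‖ ≤ η ∧
      (∀ x' y', u x' + w y' - doublingPenalty N β x₀ x' y' - ⟪p, x'⟫ - ⟪q, y'⟫ ≤
        (u s - k * ‖x - s‖ ^ 2) + (w t - k * ‖y - t‖ ^ 2) - doublingPenalty N β x₀ x y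
          - ⟪p, x⟫ - ⟪q, y⟫) ∧
      IsSuperjet u s ((2 * N) • (x - y) + (2 * β) • x + (2 * β) • (x - x₀) + p) A₁ ∧
      IsSuperjet w t (q - (2 * N) • (x - y)) A₂ ∧
      ∀ ξ ζ, ⟪A₁ ξ, ξ⟫ + ⟪A₂ ζ, ζ⟫ ≤ 2 * N * ‖ξ - ζ‖ ^ 2 + 4 * β * ‖ξ‖ ^ 2 := by
  have hk0 : 0 < k := by linarith
  obtain ⟨g₁, G₁, hlow₁, hup₁, hG₁, htouch₁⟩ := exists_c11_majorant hu hBu hk0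
  obtain ⟨g₂, G₂, hlow₂, hup₂, hG₂, htouch₂⟩ := exists_c11_majorant hw hBw hk0
  have hd₁ := hasFDerivAt_of_abs_sub_inner_le hG₁
  have hd₂ := hasFDerivAt_of_abs_sub_inner_le hG₂
  have hL₁ := lipschitzWith_of_abs_sub_inner_le (by positivity) hG₁
  have hL₂ := lipschitzWith_of_abs_sub_inner_le (by positivity) hG₂
  let fst := ContinuousLinearMap.fst ℝ V V
  let snd := ContinuousLinearMap.snd ℝ V V
  let L : V × V →L[ℝ] V × V :=
    ((-(2 * N)) • (fst - snd) - (4 * β) • fst).prod ((2 * N) • (fst - snd))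
  let T₀ : V × V → V × V := fun z => (G₁ z.1, G₂ z.2)
  let c₀ : V × V := ((2 * β) • x₀, 0)
  have hT₀ := (hL₁.comp LipschitzWith.prod_fst).prodMk (hL₂.comp LipschitzWith.prod_snd)
  have hT := (hT₀.add L.lipschitz).add (LipschitzWith.const c₀)
  obtain ⟨pq, hpq, hreg⟩ := exists_regular_value hT (lt_min hη one_pos)
  obtain ⟨p, q⟩ := pq
  have hp : ‖p‖ < min η 1 := (norm_fst_le (p, q)).trans_lt hpq
  have hq : ‖q‖ < min η 1 := (norm_snd_le (p, q)).trans_lt hpq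
  have hp1 : ‖p‖ ≤ 1 := hp.le.trans (min_le_right _ _)
  have hq1 : ‖q‖ ≤ 1 := hq.le.trans (min_le_right _ _)
  have hc₁ : Continuous g₁ := continuous_iff_continuousAt.2 fun x => (hd₁ x).continuousAt
  have hc₂ : Continuous g₂ := continuous_iff_continuousAt.2 fun x => (hd₂ x).continuousAt
  set Ψ : V × V → ℝ := fun z => g₁ z.1 + g₂ z.2 - doublingPenalty N β x₀ z.1 z.2
    - ⟪p, z.1⟫ - ⟪q, z.2⟫ with hΨ
  have hΨc : Continuous Ψ := by
    simp only [hΨ, doublingPenalty]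
    fun_prop
  set m := min N β with hm
  have hm0 : 0 < m := lt_min hN hβ
  set D : ℝ := 4 * B + β * ‖x₀‖ ^ 2 with hD
  have hB0 : 0 ≤ B := (abs_nonneg _).trans (hBu 0)
  have hD0 : 0 ≤ D := by positivity
  obtain ⟨⟨x, y⟩, hxy⟩ := exists_forall_le_of_upperSemicontinuous hΨc.upperSemicontinuous 0
    ((4 + 2 * D) / m + 1) (by
      rintro ⟨x, y⟩ hz
      have hyx : ‖y‖ ≤ ‖x‖ + ‖x - y‖ := by
        have := norm_sub_le x (x - y)
        rwa [sub_sub_cancel] at this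
      have hr : (4 + 2 * D) / m + 1 < ‖x‖ + ‖x - y‖ := by
        refine hz.trans_le ?_
        rw [Prod.norm_def]
        exact max_le (le_add_of_nonneg_right (norm_nonneg _)) hyx
      have i1 : -⟪p, x⟫ ≤ ‖x‖ := by
        have := abs_le.1 (abs_real_inner_le_norm p x)
        nlinarith [norm_nonneg x]
      have i2 : -⟪q, y⟫ ≤ ‖x‖ + ‖x - y‖ := by
        have := abs_le.1 (abs_real_inner_le_norm q y)
        nlinarith [norm_nonneg y]
      have i3 := hup₁ x
      have i4 := hup₂ y
      have i5 := hlow₁ 0 0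
      have i6 := hlow₂ 0 0
      have i7 := abs_le.1 (hBu 0)
      have i8 := abs_le.1 (hBw 0)
      simp only [sub_zero, norm_zero] at i5 i6
      have i9 : m * ‖x - y‖ ^ 2 ≤ N * ‖x - y‖ ^ 2 := by gcongr; exact min_le_left _ _
      have i10 : m * ‖x‖ ^ 2 ≤ β * ‖x‖ ^ 2 := by gcongr; exact min_le_right _ _
      have i11 : 0 ≤ β * ‖x - x₀‖ ^ 2 := by positivity
      simp only [hΨ, doublingPenalty, Prod.fst_zero, Prod.snd_zero, sub_zero, zero_sub, norm_zero,
        norm_neg, inner_zero_right]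
      set r := ‖x‖ + ‖x - y‖ with hrdef
      have i12 : m / 2 * r ^ 2 ≤ m * ‖x‖ ^ 2 + m * ‖x - y‖ ^ 2 := by
        rw [hrdef]
        nlinarith [mul_nonneg hm0.le (sq_nonneg (‖x‖ - ‖x - y‖))]
      have i13 : 4 + 2 * D ≤ m * r := by
        have : (4 + 2 * D) / m ≤ r := by linarith
        rw [div_le_iff₀ hm0] at this
        linarith
      have i14 : 1 ≤ r := by
        have : 0 ≤ (4 + 2 * D) / m := by positivity
        linarith
      have i15 : ‖x‖ ≤ r := le_add_of_nonneg_right (norm_nonneg _)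
      have i16 : D ≤ m / 2 * r ^ 2 - 2 * r := by nlinarith
      nlinarith)
  have hxy' : ∀ ξ ζ, g₁ (x + ξ) + g₂ (y + ζ) ≤ g₁ x + g₂ y
      + ⟪(2 * N) • (x - y) + (2 * β) • x + (2 * β) • (x - x₀) + p, ξ⟫
      + ⟪q - (2 * N) • (x - y), ζ⟫ + N * ‖ξ - ζ‖ ^ 2 + 2 * β * ‖ξ‖ ^ 2 := by
    intro ξ ζ
    have := hxy (x + ξ, y + ζ)
    simp only [hΨ, doublingPenalty_add, inner_add_right] at this
    rw [inner_add_left _ p, inner_sub_left q]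
    linarith
  have ht₁ : ∀ h, g₁ (x + h) ≤ g₁ x
      + ⟪(2 * N) • (x - y) + (2 * β) • x + (2 * β) • (x - x₀) + p, h⟫
      + (N + 2 * β) * ‖h‖ ^ 2 := fun h => by
    have := hxy' h 0
    rw [add_zero, inner_zero_right, sub_zero] at this
    linarith
  have ht₂ : ∀ h, g₂ (y + h) ≤ g₂ y + ⟪q - (2 * N) • (x - y), h⟫ + N * ‖h‖ ^ 2 := fun h => by
    have := hxy' 0 h
    rw [add_zero, inner_zero_right, zero_sub, norm_neg, norm_zero] at this
    linarith
  have hP₁ : G₁ x = (2 * N) • (x - y) + (2 * β) • x + (2 * β) • (x - x₀) + p :=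
    eq_of_inner_le_sq (c := 3 * k + (N + 2 * β)) fun e => by
      have h1 := (abs_le.1 (hG₁ x e)).1
      have h2 := ht₁ e
      linarith
  have hP₂ : G₂ y = q - (2 * N) • (x - y) :=
    eq_of_inner_le_sq (c := 3 * k + N) fun e => by
      have h1 := (abs_le.1 (hG₂ y e)).1
      have h2 := ht₂ e
      linarith
  obtain ⟨s, hs⟩ := htouch₁ x _ _ hk ht₁
  obtain ⟨t, ht⟩ := htouch₂ y _ _ (by linarith) ht₂
  have hdT := hreg (x, y) (by
    simp only [L, c₀, fst, snd, Function.comp]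
    ext1
    · simp [hP₁]; module
    · simp [hP₂])
  have hdT₀ : DifferentiableAt ℝ T₀ (x, y) := by
    have h1 := (hdT.sub (differentiableAt_const c₀)).sub L.differentiableAt
    refine h1.congr_of_eventuallyEq (Eventually.of_forall fun z => ?_)
    simp [T₀]
  have hD₁ : DifferentiableAt ℝ G₁ x := by
    have h1 : DifferentiableAt ℝ (fun z => (T₀ z).1) (x, y) := hdT₀.fst
    exact h1.comp x (f := fun x' => (x', y)) (by fun_prop)
  have hD₂ : DifferentiableAt ℝ G₂ y := by
    have h1 : DifferentiableAt ℝ (fun z => (T₀ z).2) (x, y) := hdT₀.snd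
    exact h1.comp y (f := fun y' => (x, y')) (by fun_prop)
  refine ⟨x, y, s, t, p, q, fderiv ℝ G₁ x, fderiv ℝ G₂ y, hp.le.trans (min_le_left _ _),
    hq.le.trans (min_le_left _ _), ?_, ?_, ?_, ?_⟩
  · intro x' y'
    have h1 := hxy (x', y')
    have h2 := hlow₁ x' x'
    have h3 := hlow₂ y' y'
    simp only [sub_self, norm_zero] at h2 h3
    simp only [hΨ] at h1
    rw [← hs, ← ht]
    linarith
  · rw [← hP₁]
    exact isSuperjet_of_majorant hlow₁ hd₁ hD₁.hasFDerivAt hs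
  · rw [← hP₂]
    exact isSuperjet_of_majorant hlow₂ hd₂ hD₂.hasFDerivAt ht
  · refine inner_add_inner_le_of_isMax hd₁ hd₂ hD₁.hasFDerivAt hD₂.hasFDerivAt ?_
    rw [hP₁, hP₂]
    exact hxy'

end Doubling

section TestFunctions

/-- Column of a matrix as a vector of Euclidean space. -/
def colVec (σ : Matrix (Fin d) (Fin d') ℝ) (l : Fin d') : E d := WithLp.toLp 2 fun k => σ k l

@[simp] lemma colVec_apply (σ : Matrix (Fin d) (Fin d') ℝ) (l : Fin d') (k : Fin d) :
    colVec σ l k = σ k l := rfl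

lemma sum_norm_colVec_sq (σ : Matrix (Fin d) (Fin d') ℝ) :
    ∑ l, ‖colVec σ l‖ ^ 2 = frobNorm σ ^ 2 := by
  rw [frobNorm, Real.sq_sqrt (by positivity), Finset.sum_comm]
  simp [EuclideanSpace.norm_sq_eq]

lemma colVec_eq_sum (σ : Matrix (Fin d) (Fin d') ℝ) (l : Fin d') :
    colVec σ l = ∑ k, σ k l • EuclideanSpace.single k (1 : ℝ) := by
  ext k
  simp [Finset.sum_apply, Pi.single_apply]

/-- Second derivative of `φ` at `x` in the direction `v`. -/
def secondDeriv (φ : E d → ℝ) (x v : E d) : ℝ := fderiv ℝ (fderiv ℝ φ) x v v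

lemma trace_mul_hess (φ : E d → ℝ) (x : E d) (σ : Matrix (Fin d) (Fin d') ℝ) :
    Matrix.trace (((1 : ℝ) / 2) • (σ * σᵀ) * hess φ x) =
      1 / 2 * ∑ l, secondDeriv φ x (colVec σ l) := by
  have h : ∀ l, secondDeriv φ x (colVec σ l) =
      ∑ k, ∑ k', σ k l * σ k' l * hess φ x k k' := fun l => by
    unfold secondDeriv
    conv_lhs => rw [colVec_eq_sum]
    simp only [map_sum, map_smul, _root_.sum_apply, _root_.smul_apply,
      smul_eq_mul]
    simp only [Finset.mul_sum]
    rw [Finset.sum_comm]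
    refine Finset.sum_congr rfl fun k _ => Finset.sum_congr rfl fun k' _ => ?_
    simp only [hess, Matrix.of_apply, iteratedFDeriv_two_apply]
    simp
    ring
  simp only [h, Matrix.trace, Matrix.diag, Matrix.mul_apply, Matrix.smul_apply,
    Matrix.transpose_apply, smul_eq_mul, Finset.mul_sum, Finset.sum_mul]
  rw [Finset.sum_comm]
  conv_rhs => rw [Finset.sum_comm]; enter [2, k]; rw [Finset.sum_comm]
  refine Finset.sum_congr rfl fun k _ => Finset.sum_congr rfl fun k' _ =>
    Finset.sum_congr rfl fun l _ => by ring

/-- Quadratic test function with gradient `p` and Hessian (the symmetric part of) `A` at `s`. -/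
def quadTest (p : E d) (A : E d →L[ℝ] E d) (s y : E d) : ℝ :=
  ⟪p, y - s⟫ + 1 / 2 * ⟪A (y - s), y - s⟫

lemma contDiff_quadTest (p : E d) (A : E d →L[ℝ] E d) (s : E d) {n : WithTop ℕ∞} :
    ContDiff ℝ n (quadTest p A s) := by
  unfold quadTest
  have h : ContDiff ℝ n fun y : E d => y - s := contDiff_id.sub contDiff_const
  exact (contDiff_const.inner ℝ h).add (contDiff_const.mul ((A.contDiff.comp h).inner ℝ h))

lemma hasFDerivAt_quadTest (p : E d) (A : E d →L[ℝ] E d) (s y : E d) :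
    HasFDerivAt (quadTest p A s) (innerSL ℝ p +
      (1 / 2 : ℝ) • (innerSL ℝ (A (y - s)) + (innerSL ℝ (y - s)).comp A)) y := by
  unfold quadTest
  have h : HasFDerivAt (fun y : E d => y - s) (ContinuousLinearMap.id ℝ (E d)) y :=
    (hasFDerivAt_id y).sub_const s
  have h1 := (hasFDerivAt_const p y).inner ℝ h
  have h2 := ((A.hasFDerivAt.comp y h).inner ℝ h).const_mul (1 / 2 : ℝ)
  refine (h1.add h2).congr_fderiv ?_
  ext v
  simp [real_inner_comm, inner_sub_left, inner_sub_right]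
  ring

lemma gradient_quadTest (p : E d) (A : E d →L[ℝ] E d) (s : E d) :
    gradient (quadTest p A s) s = p := by
  refine HasGradientAt.gradient ?_
  rw [hasGradientAt_iff_hasFDerivAt]
  refine (hasFDerivAt_quadTest p A s s).congr_fderiv ?_
  ext v
  simp

lemma secondDeriv_quadTest (p : E d) (A : E d →L[ℝ] E d) (s x v : E d) :
    secondDeriv (quadTest p A s) x v = ⟪A v, v⟫ := by
  have h : fderiv ℝ (quadTest p A s) = fun y => innerSL ℝ p +
      (1 / 2 : ℝ) • (innerSL ℝ (A (y - s)) + (innerSL ℝ (y - s)).comp A) :=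
    funext fun y => (hasFDerivAt_quadTest p A s y).fderiv
  let T : E d →L[ℝ] (E d →L[ℝ] ℝ) := (1 / 2 : ℝ) • ((innerSL ℝ).comp A +
    ((ContinuousLinearMap.compL ℝ (E d) (E d) ℝ).flip A).comp (innerSL ℝ))
  have h' : fderiv ℝ (quadTest p A s) = fun y => innerSL ℝ p + T (y - s) := by
    rw [h]; ext y v; simp [T]
  have h2 : HasFDerivAt (fderiv ℝ (quadTest p A s)) T x := by
    rw [h']
    exact (T.hasFDerivAt.comp x ((hasFDerivAt_id x).sub_const s)).const_add _
  rw [secondDeriv, h2.fderiv]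
  simp [T, real_inner_comm]
  ring

lemma hasFDerivAt_gradient {φ : E d → ℝ} (hφ : ContDiff ℝ 2 φ) (x : E d) :
    HasFDerivAt φ (innerSL ℝ (gradient φ x)) x := by
  have h := (hφ.differentiable (by norm_num) x).hasGradientAt
  rw [hasGradientAt_iff_hasFDerivAt] at h
  exact h.congr_fderiv (by ext v; simp)

lemma gradient_sub {φ ψ : E d → ℝ} (hφ : ContDiff ℝ 2 φ) (hψ : ContDiff ℝ 2 ψ) (x : E d) :
    gradient (fun y => φ y - ψ y) x = gradient φ x - gradient ψ x := by
  refine HasGradientAt.gradient ?_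
  rw [hasGradientAt_iff_hasFDerivAt]
  refine ((hasFDerivAt_gradient hφ x).sub (hasFDerivAt_gradient hψ x)).congr_fderiv ?_
  ext v
  simp

lemma secondDeriv_sub {φ ψ : E d → ℝ} (hφ : ContDiff ℝ 2 φ) (hψ : ContDiff ℝ 2 ψ) (x v : E d) :
    secondDeriv (fun y => φ y - ψ y) x v = secondDeriv φ x v - secondDeriv ψ x v := by
  have h1 : ∀ {f : E d → ℝ}, ContDiff ℝ 2 f → Differentiable ℝ (fderiv ℝ f) := fun hf =>
    (hf.fderiv_right (m := 1) (by norm_num)).differentiable (by norm_num)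
  have h : fderiv ℝ (fun y => φ y - ψ y) = fun y => fderiv ℝ φ y - fderiv ℝ ψ y :=
    funext fun y => fderiv_fun_sub (hφ.differentiable (by norm_num) y)
      (hψ.differentiable (by norm_num) y)
  rw [secondDeriv, h, fderiv_fun_sub (h1 hφ x) (h1 hψ x)]
  rfl

lemma continuous_gradient {φ : E d → ℝ} (hφ : ContDiff ℝ 2 φ) : Continuous (gradient φ) := by
  unfold gradient
  exact (LinearIsometryEquiv.continuous _).comp (hφ.continuous_fderiv (by norm_num))

lemma continuous_hess {φ : E d → ℝ} (hφ : ContDiff ℝ 2 φ) : Continuous (hess φ) := by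
  refine continuous_matrix fun i j => ?_
  have h := hφ.continuous_iteratedFDeriv (m := 2) (by norm_num)
  simp only [hess, Matrix.of_apply]
  fun_prop

/-- First and second order conditions at an interior maximum. -/
lemma secondDeriv_nonpos_of_isLocalMax {φ : E d → ℝ} (hφ : ContDiff ℝ 2 φ) {x : E d}
    (hx : IsLocalMax φ x) : gradient φ x = 0 ∧ ∀ v, secondDeriv φ x v ≤ 0 := by
  have hg : gradient φ x = 0 := by
    rw [gradient, hx.fderiv_eq_zero, map_zero]
  refine ⟨hg, fun v => le_of_forall_pos_le_add fun ε hε => ?_⟩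
  have hd : HasFDerivAt (fderiv ℝ φ) (fderiv ℝ (fderiv ℝ φ) x) x :=
    ((hφ.fderiv_right (m := 1) (by norm_num)).differentiable (by norm_num) x).hasFDerivAt
  let J := (InnerProductSpace.toDual ℝ (E d)).symm.toContinuousLinearEquiv.toContinuousLinearMap
  have hA : HasFDerivAt (gradient φ) (J.comp (fderiv ℝ (fderiv ℝ φ) x)) x :=
    J.hasFDerivAt.comp x hd
  have hη : 0 < ε / (2 * (‖v‖ ^ 2 + 1)) := by positivity
  have hcont : Tendsto (fun t : ℝ => t • v) (𝓝[>] 0) (𝓝 0) := by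
    have : Continuous fun t : ℝ => t • v := by fun_prop
    have h := this.tendsto 0
    rw [zero_smul] at h
    exact h.mono_left nhdsWithin_le_nhds
  have e1 := hcont.eventually (eventually_taylor_two (hasFDerivAt_gradient hφ) hA hη)
  have hx' : ∀ᶠ h in 𝓝 (0 : E d), φ (x + h) ≤ φ x := by
    have : Tendsto (fun h : E d => x + h) (𝓝 0) (𝓝 x) := by
      have h : Continuous fun h : E d => x + h := by fun_prop
      simpa using h.tendsto 0
    exact this.eventually hx
  obtain ⟨t, h1, h2, ht⟩ := (e1.and ((hcont.eventually hx').and self_mem_nhdsWithin)).exists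
  have ht' : 0 < t := ht
  have h3 := (abs_le.1 h1).1
  have hJ : ∀ w z : E d, ⟪J (fderiv ℝ (fderiv ℝ φ) x w), z⟫ = fderiv ℝ (fderiv ℝ φ) x w z :=
    fun w z => InnerProductSpace.toDual_symm_apply
  rw [ContinuousLinearMap.comp_apply, hJ] at h3
  simp only [hg, inner_zero_left, map_smul,
    _root_.smul_apply, smul_eq_mul, norm_smul, mul_pow,
    Real.norm_of_nonneg ht'.le] at h3
  have h4 : t ^ 2 * secondDeriv φ x v ≤ t ^ 2 * (2 * (ε / (2 * (‖v‖ ^ 2 + 1)) * ‖v‖ ^ 2)) := by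
    unfold secondDeriv
    nlinarith
  have h5 := le_of_mul_le_mul_left h4 (by positivity)
  have h6 : 2 * (ε / (2 * (‖v‖ ^ 2 + 1)) * ‖v‖ ^ 2) ≤ ε := by
    have : 2 * (ε / (2 * (‖v‖ ^ 2 + 1)) * (‖v‖ ^ 2 + 1)) = ε := by field_simp
    nlinarith
  linarith

/-- A function touched from above by a subsolution test function is itself compared to it. -/
lemma gradient_eq_and_secondDeriv_le {φ ψ : E d → ℝ} (hφ : ContDiff ℝ 2 φ) (hψ : ContDiff ℝ 2 ψ)
    {x : E d} (hx : IsLocalMax (fun y => φ y - ψ y) x) :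
    gradient φ x = gradient ψ x ∧ ∀ v, secondDeriv φ x v ≤ secondDeriv ψ x v := by
  obtain ⟨h1, h2⟩ := secondDeriv_nonpos_of_isLocalMax (hφ.sub hψ) hx
  refine ⟨?_, fun v => ?_⟩
  · have := gradient_sub hφ hψ x
    rw [h1] at this
    exact (sub_eq_zero.1 this.symm)
  · have := h2 v
    rw [secondDeriv_sub hφ hψ] at this
    linarith

lemma IsSuperjet.isLocalMax {u : E d → ℝ} {s p : E d} {A : E d →L[ℝ] E d}
    (h : IsSuperjet u s p A) {η : ℝ} (hη : 0 < η) :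
    IsLocalMax (fun y => u y - quadTest p (A + (2 * η) • ContinuousLinearMap.id ℝ (E d)) s y)
      s := by
  have ht : Tendsto (fun y : E d => y - s) (𝓝 s) (𝓝 0) := by
    have h : Continuous fun y : E d => y - s := by fun_prop
    simpa using h.tendsto s
  filter_upwards [ht.eventually (h η hη)] with y hy
  simp only [quadTest, add_sub_cancel, sub_self, inner_zero_right, inner_add_left,
    _root_.add_apply, _root_.smul_apply, ContinuousLinearMap.id_apply,
    inner_smul_left, conj_trivial, real_inner_self_eq_norm_sq] at hy ⊢
  linarith

lemma IsSubsolution.exists_of_isSuperjet {F : Op d M} {u : Fin M → E d → ℝ}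
    (hu : IsSubsolution F u) {i : Fin M} {s p : E d} {A : E d →L[ℝ] E d}
    (h : IsSuperjet (u i) s p A) {η : ℝ} (hη : 0 < η) (d' : ℕ) :
    ∃ X, F i s u p X ≤ 0 ∧ ∀ σ : Matrix (Fin d) (Fin d') ℝ,
      Matrix.trace (((1 : ℝ) / 2) • (σ * σᵀ) * X) =
        1 / 2 * ∑ l, (⟪A (colVec σ l), colVec σ l⟫ + 2 * η * ‖colVec σ l‖ ^ 2) := by
  have h1 := hu.2 i _ (contDiff_quadTest p _ s) s (h.isLocalMax hη)
  rw [gradient_quadTest] at h1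
  refine ⟨_, h1, fun σ => ?_⟩
  rw [trace_mul_hess]
  simp [secondDeriv_quadTest, inner_add_left, inner_smul_left]

lemma IsSupersolution.exists_of_isSuperjet {F : Op d M} {v : Fin M → E d → ℝ}
    (hv : IsSupersolution F v) {i : Fin M} {t q : E d} {A : E d →L[ℝ] E d}
    (h : IsSuperjet (fun y => -v i y) t q A) {η : ℝ} (hη : 0 < η) (d' : ℕ) :
    ∃ X, 0 ≤ F i t v (-q) X ∧ ∀ σ : Matrix (Fin d) (Fin d') ℝ,
      Matrix.trace (((1 : ℝ) / 2) • (σ * σᵀ) * X) =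
        -(1 / 2 * ∑ l, (⟪A (colVec σ l), colVec σ l⟫ + 2 * η * ‖colVec σ l‖ ^ 2)) := by
  set B := A + (2 * η) • ContinuousLinearMap.id ℝ (E d) with hB
  have hneg : ∀ y, quadTest (-q) (-B) t y = -quadTest q B t y := fun y => by
    simp only [quadTest, _root_.neg_apply, inner_neg_left]
    ring
  have hmin : IsLocalMin (fun y => v i y - quadTest (-q) (-B) t y) t := by
    filter_upwards [h.isLocalMax hη] with y hy
    rw [hneg, hneg]
    linarith
  have h1 := hv.2 i _ (contDiff_quadTest (-q) _ t) t hmin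
  rw [gradient_quadTest] at h1
  refine ⟨_, h1, fun σ => ?_⟩
  rw [trace_mul_hess]
  simp [secondDeriv_quadTest, hB, inner_add_left, inner_smul_left,
    Finset.sum_add_distrib]
  ring

end TestFunctions

section UniformContinuity

variable {ι X : Type*} [TopologicalSpace X]

/-- A family of real functions which is bounded and equicontinuous at a point. -/
def BddEquicontAt (f : ι → X → ℝ) (x₀ : X) : Prop :=
  (∃ B, ∀ a, |f a x₀| ≤ B) ∧ ∀ ε > 0, ∀ᶠ x in 𝓝 x₀, ∀ a, |f a x - f a x₀| ≤ ε

lemma BddEquicontAt.of_continuousAt {g : X → ℝ} {x₀ : X} (hg : ContinuousAt g x₀) :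
    BddEquicontAt (fun _ : ι => g) x₀ := by
  refine ⟨⟨_, fun _ => le_rfl⟩, fun ε hε => ?_⟩
  filter_upwards [Metric.tendsto_nhds.1 hg ε hε] with x hx a
  exact hx.le

lemma BddEquicontAt.add {f g : ι → X → ℝ} {x₀ : X} (hf : BddEquicontAt f x₀)
    (hg : BddEquicontAt g x₀) : BddEquicontAt (fun a x => f a x + g a x) x₀ := by
  obtain ⟨⟨B, hB⟩, hf⟩ := hf
  obtain ⟨⟨B', hB'⟩, hg⟩ := hg
  refine ⟨⟨B + B', fun a => (abs_add_le _ _).trans (add_le_add (hB a) (hB' a))⟩, fun ε hε => ?_⟩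
  filter_upwards [hf (ε / 2) (by positivity), hg (ε / 2) (by positivity)] with x h1 h2 a
  have := abs_add_le (f a x - f a x₀) (g a x - g a x₀)
  rw [show f a x + g a x - (f a x₀ + g a x₀) = f a x - f a x₀ + (g a x - g a x₀) by ring]
  linarith [h1 a, h2 a]

lemma BddEquicontAt.mul {f g : ι → X → ℝ} {x₀ : X} (hf : BddEquicontAt f x₀)
    (hg : BddEquicontAt g x₀) : BddEquicontAt (fun a x => f a x * g a x) x₀ := by
  obtain ⟨⟨B, hB⟩, hf⟩ := hf
  obtain ⟨⟨B', hB'⟩, hg⟩ := hg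
  wlog hι : Nonempty ι
  · have : IsEmpty ι := not_nonempty_iff.1 hι
    exact ⟨⟨0, fun a => isEmptyElim a⟩, fun ε _ => Eventually.of_forall fun x a => isEmptyElim a⟩
  obtain ⟨a₀⟩ := hι
  have hB0 : 0 ≤ B := (abs_nonneg _).trans (hB a₀)
  have hB0' : 0 ≤ B' := (abs_nonneg _).trans (hB' a₀)
  refine ⟨⟨B * B', fun a => ?_⟩, fun ε hε => ?_⟩
  · rw [abs_mul]
    exact mul_le_mul (hB a) (hB' a) (abs_nonneg _) hB0
  · set δ := min 1 (ε / (B + B' + 1)) with hδ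
    have hδ0 : 0 < δ := by positivity
    have hδ1 : δ ≤ 1 := min_le_left _ _
    have hδ2 : δ * (B + B' + 1) ≤ ε := by
      have : δ ≤ ε / (B + B' + 1) := min_le_right _ _
      rwa [le_div_iff₀ (by positivity)] at this
    filter_upwards [hf δ hδ0, hg δ hδ0] with x h1 h2 a
    rw [show f a x * g a x - f a x₀ * g a x₀ = (f a x - f a x₀) * (g a x - g a x₀)
      + (f a x - f a x₀) * g a x₀ + f a x₀ * (g a x - g a x₀) by ring]
    refine (abs_add_three _ _ _).trans ?_
    simp only [abs_mul]
    have i1 := mul_le_mul (h1 a) (h2 a) (abs_nonneg _) hδ0.le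
    have i2 := mul_le_mul (h1 a) (hB' a) (abs_nonneg _) hδ0.le
    have i3 := mul_le_mul (hB a) (h2 a) (abs_nonneg _) hB0
    nlinarith

lemma BddEquicontAt.neg {f : ι → X → ℝ} {x₀ : X} (hf : BddEquicontAt f x₀) :
    BddEquicontAt (fun a x => -f a x) x₀ := by
  simpa using (BddEquicontAt.of_continuousAt (ι := ι) (g := fun _ => (-1 : ℝ))
    continuousAt_const).mul hf

lemma BddEquicontAt.sub {f g : ι → X → ℝ} {x₀ : X} (hf : BddEquicontAt f x₀)
    (hg : BddEquicontAt g x₀) : BddEquicontAt (fun a x => f a x - g a x) x₀ := by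
  simpa [sub_eq_add_neg] using hf.add hg.neg

lemma BddEquicontAt.sum {κ : Type*} (s : Finset κ) {f : κ → ι → X → ℝ} {x₀ : X}
    (hf : ∀ k ∈ s, BddEquicontAt (f k) x₀) :
    BddEquicontAt (fun a x => ∑ k ∈ s, f k a x) x₀ := by
  classical
  induction s using Finset.induction_on with
  | empty =>
    simp only [Finset.sum_empty]
    exact BddEquicontAt.of_continuousAt continuousAt_const
  | insert k s hk ih =>
    simp only [Finset.sum_insert hk]
    exact (hf k (Finset.mem_insert_self _ _)).add
      (ih fun j hj => hf j (Finset.mem_insert_of_mem hj))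

lemma BddEquicontAt.of_lipschitz {Y : Type*} [SeminormedAddCommGroup Y] {f : ι → Y → ℝ} {C : ℝ}
    (hC : ∀ a y, |f a y| ≤ C) (hL : ∀ a y y', |f a y - f a y'| ≤ C * ‖y - y'‖)
    {g : X → Y} {x₀ : X} (hg : ContinuousAt g x₀) :
    BddEquicontAt (fun a x => f a (g x)) x₀ := by
  refine ⟨⟨C, fun a => hC a _⟩, fun ε hε => ?_⟩
  have ht : Tendsto (fun x => C * ‖g x - g x₀‖) (𝓝 x₀) (𝓝 0) := by
    have : Tendsto (fun x => C * ‖g x - g x₀‖) (𝓝 x₀) (𝓝 (C * ‖g x₀ - g x₀‖)) :=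
      ((hg.sub continuousAt_const).norm).const_mul C
    simpa using this
  filter_upwards [ht.eventually (gt_mem_nhds hε)] with x hx a
  exact (hL a _ _).trans hx.le

lemma BddEquicontAt.continuousAt_sSup [Nonempty ι] {f : ι → X → ℝ} {x₀ : X}
    (hf : BddEquicontAt f x₀) : ContinuousAt (fun x => ⨆ a, f a x) x₀ := by
  obtain ⟨⟨B, hB⟩, hf⟩ := hf
  refine Metric.tendsto_nhds.2 fun ε hε => ?_
  filter_upwards [hf (ε / 2) (by positivity)] with x hx
  have hb₀ : BddAbove (Set.range fun a => f a x₀) := ⟨B, by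
    rintro _ ⟨a, rfl⟩
    exact (le_abs_self _).trans (hB a)⟩
  have hb : BddAbove (Set.range fun a => f a x) := ⟨B + ε / 2, by
    rintro _ ⟨a, rfl⟩
    have h1 := (le_abs_self _).trans (hB a)
    have h2 := (le_abs_self _).trans (hx a)
    simp only at *
    linarith⟩
  have h1 : ⨆ a, f a x ≤ (⨆ a, f a x₀) + ε / 2 := ciSup_le fun a => by
    have h1 := le_ciSup hb₀ a
    have h2 := (le_abs_self _).trans (hx a)
    linarith
  have h2 : ⨆ a, f a x₀ ≤ (⨆ a, f a x) + ε / 2 := ciSup_le fun a => by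
    have h1 := le_ciSup hb a
    have h2 := (neg_abs_le _).trans' (neg_le_neg (hx a))
    linarith
  rw [Real.dist_eq, abs_lt]
  constructor <;> linarith

end UniformContinuity

section Hamiltonian

variable {P : HJBData d d' M 𝒜} {C lam0 : ℝ}

lemma abs_apply_le_frobNorm (A : Matrix (Fin d) (Fin d') ℝ) (k : Fin d) (l : Fin d') :
    |A k l| ≤ frobNorm A := by
  refine Real.abs_le_sqrt ?_
  refine (Finset.single_le_sum (f := fun l => A k l ^ 2) (fun _ _ => sq_nonneg _)
    (Finset.mem_univ l)).trans ?_
  exact Finset.single_le_sum (f := fun k => ∑ l, A k l ^ 2)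
    (fun _ _ => Finset.sum_nonneg fun _ _ => sq_nonneg _) (Finset.mem_univ k)

lemma abs_apply_le_norm (v : E d) (k : Fin d) : |v k| ≤ ‖v‖ := by
  simpa using PiLp.norm_apply_le v k

lemma H1.bddEquicontAt (h1 : H1 P C lam0) (i : Fin M)
    (z₀ : E d × (Fin M → ℝ) × E d × Matrix (Fin d) (Fin d) ℝ) :
    BddEquicontAt (fun (α : P.A i) (z : E d × (Fin M → ℝ) × E d × Matrix (Fin d) (Fin d) ℝ) =>
      P.L i α z.1 z.2.1 z.2.2.1 z.2.2.2) z₀ := by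
  have H := h1.2.2 i
  have hx : ContinuousAt (fun z : E d × (Fin M → ℝ) × E d × Matrix (Fin d) (Fin d) ℝ => z.1) z₀ :=
    continuousAt_fst
  have hσ : ∀ k l, BddEquicontAt (fun (α : P.A i) (z : E d × (Fin M → ℝ) × E d ×
      Matrix (Fin d) (Fin d) ℝ) => P.σm i α z.1 k l) z₀ := fun k l => by
    refine BddEquicontAt.of_lipschitz (f := fun (α : P.A i) x => P.σm i α x k l) (C := C)
      (fun α x => ?_) (fun α x y => ?_) hx
    · exact (abs_apply_le_frobNorm _ k l).trans ((H α α.2).2.2.2.2.2.1 x)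
    · exact (abs_apply_le_frobNorm (P.σm i α x - P.σm i α y) k l).trans
        ((H α α.2).2.2.2.2.2.2.1 x y)
  have hb : ∀ k, BddEquicontAt (fun (α : P.A i) (z : E d × (Fin M → ℝ) × E d ×
      Matrix (Fin d) (Fin d) ℝ) => P.bv i α z.1 k) z₀ := fun k => by
    refine BddEquicontAt.of_lipschitz (f := fun (α : P.A i) x => P.bv i α x k) (C := C)
      (fun α x => ?_) (fun α x y => ?_) hx
    · exact (abs_apply_le_norm _ k).trans ((H α α.2).2.2.2.2.2.2.2.1 x)
    · exact (abs_apply_le_norm (P.bv i α x - P.bv i α y) k).trans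
        ((H α α.2).2.2.2.2.2.2.2.2.1 x y)
  have hc : BddEquicontAt (fun (α : P.A i) (z : E d × (Fin M → ℝ) × E d ×
      Matrix (Fin d) (Fin d) ℝ) => P.cz i α z.1) z₀ :=
    BddEquicontAt.of_lipschitz (f := fun (α : P.A i) x => P.cz i α x) (C := C)
      (fun α x => (H α α.2).2.2.2.2.2.2.2.2.2.1 x)
      (fun α x y => (H α α.2).2.2.2.2.2.2.2.2.2.2.1 x y) hx
  have hl : BddEquicontAt (fun (α : P.A i) (z : E d × (Fin M → ℝ) × E d ×
      Matrix (Fin d) (Fin d) ℝ) => P.runCost i α z.1) z₀ :=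
    BddEquicontAt.of_lipschitz (f := fun (α : P.A i) x => P.runCost i α x) (C := C)
      (fun α x => (H α α.2).2.2.2.2.2.2.2.2.2.2.2.1 x)
      (fun α x y => (H α α.2).2.2.2.2.2.2.2.2.2.2.2.2.1 x y) hx
  have hd : ∀ j, BddEquicontAt (fun (α : P.A i) (z : E d × (Fin M → ℝ) × E d ×
      Matrix (Fin d) (Fin d) ℝ) => P.dcp i j α z.1) z₀ := fun j =>
    BddEquicontAt.of_lipschitz (f := fun (α : P.A i) x => P.dcp i j α x) (C := C)
      (fun α x => ((H α α.2).2.2.2.2.2.2.2.2.2.2.2.2.2.1 j).1 x)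
      (fun α x y => ((H α α.2).2.2.2.2.2.2.2.2.2.2.2.2.2.1 j).2 x y) hx
  have hs : ∀ j, BddEquicontAt (fun (_ : P.A i) (z : E d × (Fin M → ℝ) × E d ×
      Matrix (Fin d) (Fin d) ℝ) => z.2.1 j) z₀ := fun j =>
    BddEquicontAt.of_continuousAt (Continuous.continuousAt (by fun_prop))
  have hp : ∀ k, BddEquicontAt (fun (_ : P.A i) (z : E d × (Fin M → ℝ) × E d ×
      Matrix (Fin d) (Fin d) ℝ) => z.2.2.1 k) z₀ := fun k =>
    BddEquicontAt.of_continuousAt (Continuous.continuousAt (by fun_prop))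
  have hX : ∀ k k', BddEquicontAt (fun (_ : P.A i) (z : E d × (Fin M → ℝ) × E d ×
      Matrix (Fin d) (Fin d) ℝ) => z.2.2.2 k k') z₀ := fun k k' => by
    have : Continuous fun z : E d × (Fin M → ℝ) × E d × Matrix (Fin d) (Fin d) ℝ =>
      z.2.2.2 k k' := continuous_snd.snd.snd.matrix_elem k k'
    exact BddEquicontAt.of_continuousAt this.continuousAt
  have h12 : BddEquicontAt (fun (_ : P.A i) (_ : E d × (Fin M → ℝ) × E d ×
      Matrix (Fin d) (Fin d) ℝ) => (1 / 2 : ℝ)) z₀ :=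
    BddEquicontAt.of_continuousAt continuousAt_const
  simp only [HJBData.L, Matrix.trace, Matrix.diag, Matrix.mul_apply, Matrix.smul_apply,
    Matrix.transpose_apply, smul_eq_mul, PiLp.inner_apply, RCLike.inner_apply, conj_trivial]
  refine ((((BddEquicontAt.neg ?_).sub ?_).add (hc.mul (hs i))).sub hl).sub ?_
  · exact BddEquicontAt.sum _ fun k _ => BddEquicontAt.sum _ fun k' _ =>
      (h12.mul (BddEquicontAt.sum _ fun l _ => (hσ k l).mul (hσ k' l))).mul (hX k' k)
  · exact BddEquicontAt.sum _ fun k _ => (hp k).mul (hb k)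
  · exact BddEquicontAt.sum _ fun j _ => (hd j).mul (hs j)

lemma HJBData.Ham_eq_iSup (P : HJBData d d' M 𝒜) (i : Fin M) (x : E d) (s : Fin M → ℝ) (p : E d)
    (X : Matrix (Fin d) (Fin d) ℝ) : P.Ham i x s p X = ⨆ α : P.A i, P.L i α x s p X := by
  rw [HJBData.Ham, sSup_image']

lemma H1.continuous_Ham (h1 : H1 P C lam0) (i : Fin M) :
    Continuous fun z : E d × (Fin M → ℝ) × E d × Matrix (Fin d) (Fin d) ℝ =>
      P.Ham i z.1 z.2.1 z.2.2.1 z.2.2.2 := by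
  have : Nonempty (P.A i) := (h1.2.1 i).1.to_subtype
  simp only [HJBData.Ham_eq_iSup]
  exact continuous_iff_continuousAt.2 fun z => (h1.bddEquicontAt i z).continuousAt_sSup

lemma H1.L_le_Ham (h1 : H1 P C lam0) {i : Fin M} {α : 𝒜} (hα : α ∈ P.A i) (x : E d)
    (s : Fin M → ℝ) (p : E d) (X : Matrix (Fin d) (Fin d) ℝ) :
    P.L i α x s p X ≤ P.Ham i x s p X := by
  obtain ⟨⟨B, hB⟩, -⟩ := h1.bddEquicontAt i (x, s, p, X)
  refine le_csSup ⟨B, ?_⟩ (Set.mem_image_of_mem _ hα)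
  rintro _ ⟨a, ha, rfl⟩
  exact (le_abs_self _).trans (hB ⟨a, ha⟩)

lemma H1.Ham_le (h1 : H1 P C lam0) {i : Fin M} {x : E d} {s : Fin M → ℝ} {p : E d}
    {X : Matrix (Fin d) (Fin d) ℝ} {c : ℝ} (h : ∀ α ∈ P.A i, P.L i α x s p X ≤ c) :
    P.Ham i x s p X ≤ c := by
  refine csSup_le ((h1.2.1 i).1.image _) ?_
  rintro _ ⟨a, ha, rfl⟩
  exact h a ha

lemma H1.exists_lt_L (h1 : H1 P C lam0) {i : Fin M} {x : E d} {s : Fin M → ℝ} {p : E d}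
    {X : Matrix (Fin d) (Fin d) ℝ} {c : ℝ} (h : c < P.Ham i x s p X) :
    ∃ α ∈ P.A i, c < P.L i α x s p X := by
  obtain ⟨_, ⟨a, ha, rfl⟩, hc⟩ := exists_lt_of_lt_csSup ((h1.2.1 i).1.image _) h
  exact ⟨a, ha, hc⟩

/-- Monotonicity of the Hamiltonian: quasi-monotone in the coupling, degenerate elliptic. -/
lemma H1.Ham_le_Ham (h1 : H1 P C lam0) {i : Fin M} {x : E d} {s s' : Fin M → ℝ} {p : E d}
    {X X' : Matrix (Fin d) (Fin d) ℝ} (hi : s i = s' i) (hs : ∀ j, s' j ≤ s j)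
    (hX : ∀ σ : Matrix (Fin d) (Fin d') ℝ, Matrix.trace (((1 : ℝ) / 2) • (σ * σᵀ) * X') ≤
      Matrix.trace (((1 : ℝ) / 2) • (σ * σᵀ) * X)) :
    P.Ham i x s p X ≤ P.Ham i x s' p X' := by
  refine h1.Ham_le fun α hα => (h1.L_le_Ham hα x s' p X').trans' ?_
  have h2 := hX (P.σm i α x)
  have h3 : ∑ j ∈ Finset.univ.erase i, P.dcp i j α x * s' j ≤
      ∑ j ∈ Finset.univ.erase i, P.dcp i j α x * s j :=
    Finset.sum_le_sum fun j hj => mul_le_mul_of_nonneg_left (hs j)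
      ((h1.2.2 i α hα).2.2.2.2.2.2.2.2.2.2.2.2.2.2.1 j hj x)
  unfold HJBData.L
  rw [hi]
  linarith

end Hamiltonian

section Intervention

variable {Q : ImpulseData d M 𝒵} {κ₀ : ℝ} {i : Fin M} {u v : Fin M → E d → ℝ}

lemma H2.Mop_le (h2 : H2 Q κ₀) {B : ℝ} (hu : ∀ y, B ≤ u i y) {x : E d} {z : 𝒵}
    (hz : z ∈ Q.Z i x) : Q.Mop i u x ≤ u i (Q.Γ i x z) + Q.K i x z := by
  refine csInf_le ⟨B, ?_⟩ (Set.mem_image_of_mem _ hz)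
  rintro _ ⟨a, ha, rfl⟩
  have := h2.2.2.2.2.2 i x a ha
  have := h2.1
  simp only
  linarith [hu (Q.Γ i x a)]

lemma H2.le_Mop (h2 : H2 Q κ₀) {x : E d} {c : ℝ}
    (h : ∀ z ∈ Q.Z i x, c ≤ u i (Q.Γ i x z) + Q.K i x z) : c ≤ Q.Mop i u x := by
  refine le_csInf ((h2.2.1 i x).1.image _) ?_
  rintro _ ⟨a, ha, rfl⟩
  exact h a ha

lemma H2.exists_lt_of_Mop_lt (h2 : H2 Q κ₀) {x : E d} {c : ℝ} (h : Q.Mop i u x < c) :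
    ∃ z ∈ Q.Z i x, u i (Q.Γ i x z) + Q.K i x z < c := by
  obtain ⟨_, ⟨a, ha, rfl⟩, hc⟩ := exists_lt_of_csInf_lt ((h2.2.1 i x).1.image _) h
  exact ⟨a, ha, hc⟩

lemma H2.const_le_Mop (h2 : H2 Q κ₀) {B : ℝ} (hu : ∀ y, B ≤ u i y) (x : E d) :
    B ≤ Q.Mop i u x :=
  h2.le_Mop fun z hz => by
    have := h2.2.2.2.2.2 i x z hz
    have := h2.1
    linarith [hu (Q.Γ i x z)]

lemma H2.Mop_le_add (h2 : H2 Q κ₀) {B m : ℝ} (hu : ∀ y, B ≤ u i y)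
    (h : ∀ y, u i y ≤ v i y + m) (x : E d) : Q.Mop i u x ≤ Q.Mop i v x + m := by
  rw [← sub_le_iff_le_add]
  refine h2.le_Mop fun z hz => ?_
  have := h2.Mop_le hu hz
  linarith [h (Q.Γ i x z)]

lemma H2.Mop_mono (h2 : H2 Q κ₀) {B : ℝ} (hu : ∀ y, B ≤ u i y)
    (h : ∀ y, u i y ≤ v i y) (x : E d) : Q.Mop i u x ≤ Q.Mop i v x := by
  simpa using h2.Mop_le_add (m := 0) hu (by simpa using h) x

lemma H2.hausdorffEDist_ne_top (h2 : H2 Q κ₀) (i : Fin M) (x y : E d) :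
    Metric.hausdorffEDist (Q.Z i x) (Q.Z i y) ≠ ⊤ :=
  Metric.hausdorffEDist_ne_top_of_nonempty_of_bounded (h2.2.1 i x).1 (h2.2.1 i y).1
    (h2.2.1 i x).2.isBounded (h2.2.1 i y).2.isBounded

lemma H2.upperSemicontinuous_Mop (h2 : H2 Q κ₀) {B : ℝ} (hu : ∀ y, B ≤ u i y)
    (husc : UpperSemicontinuous (u i)) : UpperSemicontinuous fun x => Q.Mop i u x := by
  intro x₀ c hc
  obtain ⟨z₀, hz₀, hlt⟩ := h2.exists_lt_of_Mop_lt hc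
  have hf : UpperSemicontinuous fun p : E d × 𝒵 => u i (Q.Γ i p.1 p.2) + Q.K i p.1 p.2 :=
    (husc.comp (h2.2.2.1 i)).add (h2.2.2.2.1 i).upperSemicontinuous
  have hev := hf (x₀, z₀) c hlt
  rw [nhds_prod_eq] at hev
  obtain ⟨U, hU, W, hW, hUW⟩ := Filter.eventually_prod_iff.1 hev
  obtain ⟨ε, hε, hWε⟩ := Metric.eventually_nhds_iff.1 hW
  obtain ⟨δ, hδ, hZ⟩ := h2.2.2.2.2.1 i x₀ ε hε
  filter_upwards [hU, Metric.ball_mem_nhds x₀ hδ] with x hxU hxδ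
  obtain ⟨z, hz, hzd⟩ := Metric.exists_dist_lt_of_hausdorffDist_lt hz₀ (hZ x hxδ)
    (h2.hausdorffEDist_ne_top i x₀ x)
  refine (h2.Mop_le hu hz).trans_lt (hUW hxU (hWε ?_))
  rwa [dist_comm]

lemma H2.lowerSemicontinuous_Mop (h2 : H2 Q κ₀) {B : ℝ} (hu : ∀ y, B ≤ u i y)
    (hlsc : LowerSemicontinuous (u i)) : LowerSemicontinuous fun x => Q.Mop i u x := by
  intro x₀ c hc
  obtain ⟨c', hcc', hc'⟩ := exists_between hc
  have hf : LowerSemicontinuous fun p : E d × 𝒵 => u i (Q.Γ i p.1 p.2) + Q.K i p.1 p.2 :=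
    (hlsc.comp (h2.2.2.1 i)).add (h2.2.2.2.1 i).lowerSemicontinuous
  have hopen := hf.isOpen_preimage c'
  obtain ⟨U, W, hU, hW, hxU, hZW, hUW⟩ := generalized_tube_lemma (isCompact_singleton (x := x₀))
    (h2.2.1 i x₀).2 hopen (by
      rintro ⟨x, z⟩ ⟨rfl, hz⟩
      exact hc'.trans_le (h2.Mop_le hu hz))
  obtain ⟨ε, hε, hεW⟩ := (h2.2.1 i x₀).2.exists_thickening_subset_open hW hZW
  obtain ⟨δ, hδ, hZ⟩ := h2.2.2.2.2.1 i x₀ ε hε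
  filter_upwards [hU.mem_nhds (hxU rfl), Metric.ball_mem_nhds x₀ hδ] with x hxU hxδ
  refine hcc'.trans_le (h2.le_Mop fun z hz => ?_)
  obtain ⟨z₀, hz₀, hzd⟩ := Metric.exists_dist_lt_of_hausdorffDist_lt' hz (hZ x hxδ)
    (h2.hausdorffEDist_ne_top i x₀ x)
  have hzW : z ∈ W := hεW (Metric.mem_thickening_iff.2 ⟨z₀, hz₀, by rwa [dist_comm]⟩)
  exact (hUW (Set.mk_mem_prod hxU hzW)).le

end Intervention

section Comparison

variable {P : HJBData d d' M 𝒜} {Q : ImpulseData d M 𝒵} {C lam0 κ₀ : ℝ}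

lemma H1.C_nonneg (h1 : H1 P C lam0) (i : Fin M) : 0 ≤ C := by
  obtain ⟨α, hα⟩ := (h1.2.1 i).1
  exact (norm_nonneg _).trans ((h1.2.2 i α hα).2.2.2.2.2.2.2.1 0)

/-- Structure estimate for the difference of the linear operators at doubled points. -/
lemma H1.le_L_sub_L (h1 : H1 P C lam0) {i : Fin M} {α : 𝒜} (hα : α ∈ P.A i)
    {s t p₁ p₂ : E d} {X Y : Matrix (Fin d) (Fin d) ℝ} {A₁ A₂ : E d →L[ℝ] E d}
    {N β η θ B : ℝ} {U V : Fin M → ℝ} (hN : 0 ≤ N) (hβ : 0 ≤ β) (hη : 0 ≤ η) (hθ : 0 ≤ θ)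
    (hX : ∀ σ : Matrix (Fin d) (Fin d') ℝ, Matrix.trace (((1 : ℝ) / 2) • (σ * σᵀ) * X) =
      1 / 2 * ∑ l, (⟪A₁ (colVec σ l), colVec σ l⟫ + 2 * η * ‖colVec σ l‖ ^ 2))
    (hY : ∀ σ : Matrix (Fin d) (Fin d') ℝ, Matrix.trace (((1 : ℝ) / 2) • (σ * σᵀ) * Y) =
      -(1 / 2 * ∑ l, (⟪A₂ (colVec σ l), colVec σ l⟫ + 2 * η * ‖colVec σ l‖ ^ 2)))
    (hA : ∀ ξ ζ, ⟪A₁ ξ, ξ⟫ + ⟪A₂ ζ, ζ⟫ ≤ 2 * N * ‖ξ - ζ‖ ^ 2 + 4 * β * ‖ξ‖ ^ 2)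
    (hV : ∀ j, |V j| ≤ B) (hij : ∀ j, U j - V j ≤ U i - V i + θ) (h0 : 0 ≤ U i - V i) :
    lam0 * (U i - V i) - (N * C ^ 2 * ‖s - t‖ ^ 2 + 2 * β * C ^ 2 + 2 * η * C ^ 2
      + C * ‖s - t‖ * ‖p₂‖ + C * ‖p₁ - p₂‖ + M * C * θ + C * ‖s - t‖ * (1 + B + M * B)) ≤
    P.L i α s U p₁ X - P.L i α t V p₂ Y := by
  have hC := h1.C_nonneg i
  obtain ⟨-, -, -, -, -, hσ, hσL, hb, hbL, hc, hcL, hl, hlL, hd, hd0, hcd⟩ := h1.2.2 i α hα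
  have hB0 : 0 ≤ B := (abs_nonneg _).trans (hV i)
  have hst := norm_nonneg (s - t)
  -- second-order part
  have hfrob : ∀ {σ : Matrix (Fin d) (Fin d') ℝ} {K : ℝ}, 0 ≤ K → frobNorm σ ≤ K →
      ∑ l, ‖colVec σ l‖ ^ 2 ≤ K ^ 2 := fun {σ K} hK h => by
    rw [sum_norm_colVec_sq]
    exact pow_le_pow_left₀ (Real.sqrt_nonneg _) h 2
  have f1 := hfrob hC (hσ s)
  have f2 := hfrob hC (hσ t)
  have f3 := hfrob (by positivity) (hσL s t)
  have tr : Matrix.trace (((1 : ℝ) / 2) • (P.σm i α s * (P.σm i α s)ᵀ) * X)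
      - Matrix.trace (((1 : ℝ) / 2) • (P.σm i α t * (P.σm i α t)ᵀ) * Y) ≤
      N * C ^ 2 * ‖s - t‖ ^ 2 + 2 * β * C ^ 2 + 2 * η * C ^ 2 := by
    rw [hX, hY]
    have : ∑ l, (⟪A₁ (colVec (P.σm i α s) l), colVec (P.σm i α s) l⟫ +
        ⟪A₂ (colVec (P.σm i α t) l), colVec (P.σm i α t) l⟫) ≤
        ∑ l, (2 * N * ‖colVec (P.σm i α s - P.σm i α t) l‖ ^ 2
          + 4 * β * ‖colVec (P.σm i α s) l‖ ^ 2) :=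
      Finset.sum_le_sum fun l _ => hA _ _
    simp only [Finset.sum_add_distrib, ← Finset.mul_sum] at this ⊢
    have g1 := mul_le_mul_of_nonneg_left f1 hη
    have g2 := mul_le_mul_of_nonneg_left f2 hη
    have g3 := mul_le_mul_of_nonneg_left f3 hN
    have g4 := mul_le_mul_of_nonneg_left f1 hβ
    linarith
  -- drift part
  have dr : ⟪P.bv i α s, p₁⟫ - ⟪P.bv i α t, p₂⟫ ≤ C * ‖s - t‖ * ‖p₂‖ + C * ‖p₁ - p₂‖ := by
    have e : ⟪P.bv i α s, p₁⟫ - ⟪P.bv i α t, p₂⟫ =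
        ⟪P.bv i α s - P.bv i α t, p₂⟫ + ⟪P.bv i α s, p₁ - p₂⟫ := by
      rw [inner_sub_left, inner_sub_right]; ring
    rw [e]
    refine add_le_add ((real_inner_le_norm _ _).trans ?_) ((real_inner_le_norm _ _).trans ?_)
    · exact mul_le_mul_of_nonneg_right (hbL s t) (norm_nonneg _)
    · exact mul_le_mul_of_nonneg_right (hb s) (norm_nonneg _)
  -- running cost
  have rc : P.runCost i α s - P.runCost i α t ≤ C * ‖s - t‖ := (le_abs_self _).trans (hlL s t)
  -- zeroth-order part
  have z1 : (P.cz i α t - P.cz i α s) * V i ≤ C * ‖s - t‖ * B := by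
    refine (le_abs_self _).trans ?_
    rw [abs_mul, abs_sub_comm]
    exact mul_le_mul (hcL s t) (hV i) (abs_nonneg _) (by positivity)
  have hcard : ((Finset.univ.erase i).card : ℝ) ≤ M := by
    have := Finset.card_le_univ (Finset.univ.erase i)
    rw [Fintype.card_fin] at this
    exact_mod_cast this
  have z2 : ∑ j ∈ Finset.univ.erase i, (P.dcp i j α s * U j - P.dcp i j α t * V j) ≤
      (∑ j ∈ Finset.univ.erase i, P.dcp i j α s) * (U i - V i) + M * C * θ
        + C * ‖s - t‖ * (M * B) := by
    have : ∀ j ∈ Finset.univ.erase i, P.dcp i j α s * U j - P.dcp i j α t * V j ≤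
        P.dcp i j α s * (U i - V i) + (C * θ + C * ‖s - t‖ * B) := fun j hj => by
      have i1 := mul_le_mul_of_nonneg_left (hij j) (hd0 j hj s)
      have i2 : P.dcp i j α s * θ ≤ C * θ :=
        mul_le_mul_of_nonneg_right ((le_abs_self _).trans ((hd j).1 s)) hθ
      have i3 : (P.dcp i j α s - P.dcp i j α t) * V j ≤ C * ‖s - t‖ * B := by
        refine (le_abs_self _).trans ?_
        rw [abs_mul]
        exact mul_le_mul ((hd j).2 s t) (hV j) (abs_nonneg _) (by positivity)
      nlinarith
    refine (Finset.sum_le_sum this).trans ?_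
    rw [Finset.sum_add_distrib, ← Finset.sum_mul, Finset.sum_const, nsmul_eq_mul]
    have := mul_le_mul_of_nonneg_right hcard
      (show 0 ≤ C * θ + C * ‖s - t‖ * B by positivity)
    linarith
  rw [Finset.sum_sub_distrib] at z2
  have z3 := mul_le_mul_of_nonneg_right (hcd s) h0
  unfold HJBData.L
  nlinarith

/-- Inequality obtained from a pair of ordered jets at doubled points. -/
lemma lam0_mul_sub_le (h1 : H1 P C lam0) {ρ : ℝ} (hρ : 0 ≤ ρ) {u v : Fin M → E d → ℝ}
    (hu : IsSubsolution (Fpen P Q ρ) u) (hv : IsSupersolution (Fpen P Q ρ) v)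
    {i : Fin M} {s t p₁ p₂ : E d} {A₁ A₂ : E d →L[ℝ] E d} {N β η θ B m : ℝ}
    (hN : 0 ≤ N) (hβ : 0 ≤ β) (hη : 0 < η) (hθ : 0 ≤ θ)
    (hs : IsSuperjet (u i) s p₁ A₁) (ht : IsSuperjet (fun y => -v i y) t (-p₂) A₂)
    (hA : ∀ ξ ζ, ⟪A₁ ξ, ξ⟫ + ⟪A₂ ζ, ζ⟫ ≤ 2 * N * ‖ξ - ζ‖ ^ 2 + 4 * β * ‖ξ‖ ^ 2)
    (hB : ∀ j, |v j t| ≤ B) (hij : ∀ j, u j s - v j t ≤ u i s - v i t + θ)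
    (h0 : 0 ≤ u i s - v i t) (hm : Q.Mop i u s - Q.Mop i v t ≤ m)
    (hm' : u i s - v i t ≤ m) :
    lam0 * (u i s - v i t) ≤ N * C ^ 2 * ‖s - t‖ ^ 2 + 2 * β * C ^ 2 + 2 * η * C ^ 2
      + C * ‖s - t‖ * ‖p₂‖ + C * ‖p₁ - p₂‖ + M * C * θ + C * ‖s - t‖ * (1 + B + M * B)
      + ρ * (m - (u i s - v i t)) + η := by
  obtain ⟨X, hX, hXt⟩ := hu.exists_of_isSuperjet hs hη d'
  obtain ⟨Y, hY, hYt⟩ := hv.exists_of_isSuperjet ht hη d'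
  rw [neg_neg] at hY
  simp only [Fpen] at hX hY
  obtain ⟨α, hα, hlt⟩ := h1.exists_lt_L (sub_lt_self (P.Ham i t (fun j => v j t) p₂ Y) hη)
  have hL := h1.L_le_Ham hα s (fun j => u j s) p₁ X
  have key := h1.le_L_sub_L hα (s := s) (t := t) (p₁ := p₁) (p₂ := p₂) hN hβ hη.le hθ hXt hYt hA
    (V := fun j => v j t) (U := fun j => u j s) hB hij h0
  have hmax : max (v i t - Q.Mop i v t) 0 - max (u i s - Q.Mop i u s) 0 ≤
      m - (u i s - v i t) := by
    rw [sub_le_iff_le_add]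
    refine max_le ?_ ?_
    · have := le_max_left (u i s - Q.Mop i u s) 0
      linarith
    · have := le_max_right (u i s - Q.Mop i u s) 0
      linarith
  have := mul_le_mul_of_nonneg_left hmax hρ
  linarith

end Comparison

section DoublingLimit

variable {V : Type*} [NormedAddCommGroup V] [InnerProductSpace ℝ V]

/-- Quantitative consequences of near-maximality in the doubling of variables. -/
lemma doubling_estimate {u w : V → ℝ} {B β N k η : ℝ} {x₀ x y s t p q : V}
    (hBu : ∀ x, |u x| ≤ B) (hBw : ∀ x, |w x| ≤ B) (hβ : 0 < β) (hN : 1 ≤ N)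
    (hη1 : η ≤ 1) (hp : ‖p‖ ≤ η) (hq : ‖q‖ ≤ η) (hk : 0 ≤ k)
    (h : u x₀ + w x₀ - doublingPenalty N β x₀ x₀ x₀ - ⟪p, x₀⟫ - ⟪q, x₀⟫ ≤
        (u s - k * ‖x - s‖ ^ 2) + (w t - k * ‖y - t‖ ^ 2) - doublingPenalty N β x₀ x y
          - ⟪p, x⟫ - ⟪q, y⟫) {K : ℝ}
    (hK : K = 4 * B + β * ‖x₀‖ ^ 2 + 2 * ‖x₀‖ + 2 / β + 1) :
    (β / 2 * ‖x‖ ^ 2 ≤ K ∧ k * ‖x - s‖ ^ 2 ≤ K ∧ k * ‖y - t‖ ^ 2 ≤ K ∧ N / 2 * ‖x - y‖ ^ 2 ≤ K) ∧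
    k * ‖x - s‖ ^ 2 + k * ‖y - t‖ ^ 2 + N * ‖x - y‖ ^ 2 + β * ‖x - x₀‖ ^ 2 ≤
      u s + w t - β * ‖x‖ ^ 2 - (u x₀ + w x₀ - β * ‖x₀‖ ^ 2)
        + η * (2 * ‖x₀‖ + 2 * ‖x‖ + ‖x - y‖) := by
  have hyx : ‖y‖ ≤ ‖x‖ + ‖x - y‖ := by
    have := norm_sub_le x (x - y)
    rwa [sub_sub_cancel] at this
  have hin : ∀ {a b : V}, ‖a‖ ≤ η → |⟪a, b⟫| ≤ η * ‖b‖ := fun {a b} ha =>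
    (abs_real_inner_le_norm a b).trans (mul_le_mul_of_nonneg_right ha (norm_nonneg _))
  have hη0 : 0 ≤ η := (norm_nonneg _).trans hp
  have i1 := abs_le.1 (hin (b := x₀) hp)
  have i2 := abs_le.1 (hin (b := x₀) hq)
  have i3 := abs_le.1 (hin (b := x) hp)
  have i4 := abs_le.1 (hin (b := y) hq)
  have i5 := mul_le_mul_of_nonneg_left hyx hη0
  have main : k * ‖x - s‖ ^ 2 + k * ‖y - t‖ ^ 2 + N * ‖x - y‖ ^ 2 + β * ‖x - x₀‖ ^ 2 ≤
      u s + w t - β * ‖x‖ ^ 2 - (u x₀ + w x₀ - β * ‖x₀‖ ^ 2)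
        + η * (2 * ‖x₀‖ + 2 * ‖x‖ + ‖x - y‖) := by
    simp only [doublingPenalty, sub_self, norm_zero] at h
    linarith
  refine ⟨?_, main⟩
  have b1 := abs_le.1 (hBu x₀)
  have b2 := abs_le.1 (hBw x₀)
  have b3 := abs_le.1 (hBu s)
  have b4 := abs_le.1 (hBw t)
  have j1 : η * (2 * ‖x₀‖ + 2 * ‖x‖ + ‖x - y‖) ≤ 2 * ‖x₀‖ + 2 * ‖x‖ + ‖x - y‖ :=
    mul_le_of_le_one_left (by positivity) hη1
  have j2 : 2 * ‖x‖ ≤ β / 2 * ‖x‖ ^ 2 + 2 / β := by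
    have : β / 2 * ‖x‖ ^ 2 + 2 / β - 2 * ‖x‖ = (β * ‖x‖ - 2) ^ 2 / (2 * β) := by
      field_simp; ring
    have h2 : 0 ≤ (β * ‖x‖ - 2) ^ 2 / (2 * β) := by positivity
    linarith
  have j3 : ‖x - y‖ ≤ N / 2 * ‖x - y‖ ^ 2 + 1 := by nlinarith [sq_nonneg (‖x - y‖ - 1)]
  have k1 : 0 ≤ k * ‖x - s‖ ^ 2 := by positivity
  have k2 : 0 ≤ k * ‖y - t‖ ^ 2 := by positivity
  have k3 : 0 ≤ N / 2 * ‖x - y‖ ^ 2 := by positivity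
  have k4 : 0 ≤ β * ‖x - x₀‖ ^ 2 := by positivity
  have k5 : 0 ≤ β / 2 * ‖x‖ ^ 2 := by positivity
  refine ⟨?_, ?_, ?_, ?_⟩ <;> linarith

lemma le_of_mul_sq_le {k a b : ℝ} (hk : 0 < k) (hb : 0 ≤ b) (h : k * a ^ 2 ≤ k * b ^ 2) :
    a ≤ b :=
  le_of_sq_le_sq (le_of_mul_le_mul_left h hk) hb

/-- Jets at nearby points, with vanishing penalization. -/
lemma exists_small_doubling_jets [FiniteDimensional ℝ V] {u w : V → ℝ}
    (hu : UpperSemicontinuous u) (hw : UpperSemicontinuous w) {B : ℝ}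
    (hBu : ∀ x, |u x| ≤ B) (hBw : ∀ x, |w x| ≤ B) {β : ℝ} (hβ : 0 < β) {x₀ : V}
    (hmax : ∀ x, u x + w x - β * ‖x‖ ^ 2 ≤ u x₀ + w x₀ - β * ‖x₀‖ ^ 2) {δ : ℝ} (hδ0 : 0 < δ) :
    ∃ (N : ℝ) (x y s t p q : V) (A₁ A₂ : V →L[ℝ] V), 1 ≤ N ∧ ‖p‖ ≤ δ ∧ ‖q‖ ≤ δ ∧
      N * ‖x - s‖ ^ 2 ≤ 4 * δ ∧ N * ‖y - t‖ ^ 2 ≤ 4 * δ ∧ N * ‖x - y‖ ^ 2 ≤ 4 * δ ∧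
      β * ‖x - x₀‖ ^ 2 ≤ 4 * δ ∧
      u x₀ + w x₀ - β * ‖x₀‖ ^ 2 ≤ u s + w t - β * ‖x‖ ^ 2 + δ ∧
      IsSuperjet u s ((2 * N) • (x - y) + (2 * β) • x + (2 * β) • (x - x₀) + p) A₁ ∧
      IsSuperjet w t (q - (2 * N) • (x - y)) A₂ ∧
      ∀ ξ ζ, ⟪A₁ ξ, ξ⟫ + ⟪A₂ ζ, ζ⟫ ≤ 2 * N * ‖ξ - ζ‖ ^ 2 + 4 * β * ‖ξ‖ ^ 2 := by
  have hB0 : 0 ≤ B := (abs_nonneg _).trans (hBu 0)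
  have hN1 : ∀ n : ℕ, (1 : ℝ) ≤ n + 1 := fun n => by
    have : (0 : ℝ) ≤ n := n.cast_nonneg
    linarith
  have hη : ∀ n : ℕ, (0 : ℝ) < 1 / (n + 1) := fun n => by positivity
  choose x y s t p q A₁ A₂ hp hq hineq hj₁ hj₂ hA using fun n : ℕ =>
    exists_doubling_point hu hw hBu hBw (N := n + 1) (k := n + 1 + 2 * β + 1) (by positivity) hβ
      (by linarith) (hη n) x₀
  have hest := fun n => doubling_estimate hBu hBw hβ (hN1 n)
    (by rw [div_le_one (by positivity)]; exact hN1 n) (hp n) (hq n) (by positivity)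
    (hineq n x₀ x₀) rfl
  set K := 4 * B + β * ‖x₀‖ ^ 2 + 2 * ‖x₀‖ + 2 / β + 1 with hK
  have hK0 : 0 < K := by positivity
  have hinv : Tendsto (fun n : ℕ => 1 / ((n : ℝ) + 1)) atTop (𝓝 0) :=
    tendsto_one_div_add_atTop_nhds_zero_nat
  -- compactness
  have hxR : ∀ n, x n ∈ Metric.closedBall (0 : V) (2 * K / β + 1) := fun n => by
    rw [mem_closedBall_zero_iff]
    have h1 := (hest n).1.1
    have h2 : ‖x n‖ ^ 2 ≤ 2 * K / β := by
      rw [le_div_iff₀ hβ]; linarith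
    nlinarith [sq_nonneg (‖x n‖ - 1)]
  obtain ⟨z, -, φ, hφ, hxz⟩ := (isCompact_closedBall (0 : V) (2 * K / β + 1)).tendsto_subseq hxR
  have hinv' := hinv.comp hφ.tendsto_atTop
  have hzero : ∀ {f : ℕ → V}, (∀ n : ℕ, ((n : ℝ) + 1) * ‖f n‖ ^ 2 ≤ 2 * K) →
      Tendsto (fun n => f (φ n)) atTop (𝓝 0) := fun {f} hf => by
    rw [tendsto_zero_iff_norm_tendsto_zero]
    have h2 : Tendsto (fun n => ‖f (φ n)‖ ^ 2) atTop (𝓝 0) := by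
      refine squeeze_zero (fun _ => by positivity) (fun n => ?_)
        (by simpa using hinv'.const_mul (2 * K))
      rw [← div_eq_mul_inv, le_div_iff₀ (by positivity)]
      linarith [hf (φ n)]
    have h3 := h2.sqrt
    simpa [Real.sqrt_sq (norm_nonneg _)] using h3
  have hxs := hzero (f := fun n => x n - s n) fun n => by
    have h1 := (hest n).1.2.1
    have : ((n : ℝ) + 1) * ‖x n - s n‖ ^ 2 ≤ (n + 1 + 2 * β + 1) * ‖x n - s n‖ ^ 2 := by
      gcongr; linarith
    linarith
  have hyt := hzero (f := fun n => y n - t n) fun n => by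
    have h1 := (hest n).1.2.2.1
    have : ((n : ℝ) + 1) * ‖y n - t n‖ ^ 2 ≤ (n + 1 + 2 * β + 1) * ‖y n - t n‖ ^ 2 := by
      gcongr; linarith
    linarith
  have hxy := hzero (f := fun n => x n - y n) fun n => by
    have h1 := (hest n).1.2.2.2
    linarith
  have hxz' : Tendsto (fun n => x (φ n)) atTop (𝓝 z) := hxz
  have hs : Tendsto (fun n => s (φ n)) atTop (𝓝 z) := by
    simpa using hxz'.sub hxs
  have ht : Tendsto (fun n => t (φ n)) atTop (𝓝 z) := by
    simpa using (hxz'.sub hxy).sub hyt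
  have e1 := hs.eventually (hu z (u z + δ) (by linarith))
  have e2 := ht.eventually (hw z (w z + δ) (by linarith))
  have e3 : ∀ᶠ n in atTop, β * ‖z‖ ^ 2 - δ < β * ‖x (φ n)‖ ^ 2 :=
    ((hxz'.norm.pow 2).const_mul β).eventually (lt_mem_nhds (by linarith))
  have e4 : ∀ᶠ n in atTop, 1 / ((φ n : ℝ) + 1) *
      (2 * ‖x₀‖ + 2 * ‖x (φ n)‖ + ‖x (φ n) - y (φ n)‖) < δ := by
    have : Tendsto (fun n => 1 / ((φ n : ℝ) + 1) *
        (2 * ‖x₀‖ + 2 * ‖x (φ n)‖ + ‖x (φ n) - y (φ n)‖)) atTop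
        (𝓝 (0 * (2 * ‖x₀‖ + 2 * ‖z‖ + ‖(0 : V)‖))) :=
      hinv'.mul ((tendsto_const_nhds.add (hxz'.norm.const_mul 2)).add hxy.norm)
    rw [zero_mul] at this
    exact this.eventually (gt_mem_nhds hδ0)
  have e5 : ∀ᶠ n in atTop, 1 / ((φ n : ℝ) + 1) < δ := hinv'.eventually (gt_mem_nhds hδ0)
  obtain ⟨n, h1, h2, h3, h4, h5⟩ := (e1.and (e2.and (e3.and (e4.and e5)))).exists
  obtain ⟨-, hrest⟩ := hest (φ n)
  have hz := hmax z
  set k : ℝ := (φ n : ℝ) + 1 + 2 * β + 1 with hk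
  set N : ℝ := (φ n : ℝ) + 1
  have hNk : N ≤ k := by rw [hk]; linarith
  have hN1' : 1 ≤ N := hN1 _
  have hxs0 : N * ‖x (φ n) - s (φ n)‖ ^ 2 ≤ k * ‖x (φ n) - s (φ n)‖ ^ 2 := by gcongr
  have hyt0 : N * ‖y (φ n) - t (φ n)‖ ^ 2 ≤ k * ‖y (φ n) - t (φ n)‖ ^ 2 := by gcongr
  have r1 : 0 ≤ N * ‖x (φ n) - s (φ n)‖ ^ 2 := by positivity
  have r2 : 0 ≤ N * ‖y (φ n) - t (φ n)‖ ^ 2 := by positivity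
  have r3 : 0 ≤ N * ‖x (φ n) - y (φ n)‖ ^ 2 := by positivity
  have r4 : 0 ≤ β * ‖x (φ n) - x₀‖ ^ 2 := by positivity
  refine ⟨N, x (φ n), y (φ n), s (φ n), t (φ n), p (φ n), q (φ n), A₁ (φ n), A₂ (φ n), hN1',
    (hp _).trans h5.le, (hq _).trans h5.le, by linarith, by linarith, by linarith, by linarith,
    by linarith, hj₁ _, hj₂ _, hA _⟩

/-- Ordered jets arbitrarily close to a strict maximum point of `u + w - β ‖·‖²`. -/
lemma exists_doubling_jets [FiniteDimensional ℝ V] {u w : V → ℝ}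
    (hu : UpperSemicontinuous u) (hw : UpperSemicontinuous w) {B : ℝ}
    (hBu : ∀ x, |u x| ≤ B) (hBw : ∀ x, |w x| ≤ B) {β : ℝ} (hβ : 0 < β) {x₀ : V}
    (hmax : ∀ x, u x + w x - β * ‖x‖ ^ 2 ≤ u x₀ + w x₀ - β * ‖x₀‖ ^ 2) {ε : ℝ} (hε : 0 < ε) :
    ∃ (N : ℝ) (x y s t p q : V) (A₁ A₂ : V →L[ℝ] V), 0 < N ∧ ‖p‖ ≤ ε ∧ ‖q‖ ≤ ε ∧
      ‖x - x₀‖ ≤ ε ∧ ‖s - x₀‖ ≤ ε ∧ ‖t - x₀‖ ≤ ε ∧ N * ‖s - t‖ ^ 2 ≤ ε ∧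
      N * (‖s - t‖ * ‖x - y‖) ≤ ε ∧ u x₀ + w x₀ - ε ≤ u s + w t ∧
      IsSuperjet u s ((2 * N) • (x - y) + (2 * β) • x + (2 * β) • (x - x₀) + p) A₁ ∧
      IsSuperjet w t (q - (2 * N) • (x - y)) A₂ ∧
      ∀ ξ ζ, ⟪A₁ ξ, ξ⟫ + ⟪A₂ ζ, ζ⟫ ≤ 2 * N * ‖ξ - ζ‖ ^ 2 + 4 * β * ‖ξ‖ ^ 2 := by
  set ε₁ := min (ε / 3) (ε / (2 * (2 * β * ‖x₀‖ + 1))) with hε₁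
  have hε₁0 : 0 < ε₁ := by positivity
  set δ := min (ε / 40) (min (ε₁ ^ 2 / 4) (β * ε₁ ^ 2 / 4)) with hδ
  have hδ0 : 0 < δ := by positivity
  obtain ⟨N, x, y, s, t, p, q, A₁, A₂, hN1', hp, hq, r1, r2, r3, r4, hval, hj₁, hj₂, hA⟩ :=
    exists_small_doubling_jets hu hw hBu hBw hβ hmax hδ0
  have d1 : 40 * δ ≤ ε := by
    have : δ ≤ ε / 40 := min_le_left _ _
    linarith
  have d2 : 4 * δ ≤ ε₁ ^ 2 := by
    have : δ ≤ ε₁ ^ 2 / 4 := (min_le_right _ _).trans (min_le_left _ _)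
    linarith
  have d3 : 4 * δ ≤ β * ε₁ ^ 2 := by
    have : δ ≤ β * ε₁ ^ 2 / 4 := (min_le_right _ _).trans (min_le_right _ _)
    linarith
  have hsmall : ∀ {a : V}, N * ‖a‖ ^ 2 ≤ 4 * δ → ‖a‖ ≤ ε₁ := fun {a} ha =>
    le_of_mul_sq_le (k := 1) one_pos hε₁0.le (by nlinarith [sq_nonneg ‖a‖])
  have n1 : ‖x - s‖ ≤ ε₁ := hsmall (by linarith)
  have n2 : ‖y - t‖ ≤ ε₁ := hsmall (by linarith)
  have n3 : ‖x - y‖ ≤ ε₁ := hsmall (by linarith)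
  have n4 : ‖x - x₀‖ ≤ ε₁ := le_of_mul_sq_le hβ hε₁0.le (by linarith)
  have hε₁ε : 3 * ε₁ ≤ ε := by
    have : ε₁ ≤ ε / 3 := min_le_left _ _
    linarith
  have hst : ‖s - t‖ ≤ ‖x - s‖ + ‖x - y‖
      + ‖y - t‖ := by
    rw [show s - t = -(x - s) + (x - y)
      + (y - t) by abel]
    refine (norm_add₃_le).trans ?_
    rw [norm_neg]
  have hst2 : N * ‖s - t‖ ^ 2 ≤ 36 * δ := by
    have : ‖s - t‖ ^ 2 ≤ 3 * (‖x - s‖ ^ 2 + ‖x - y‖ ^ 2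
        + ‖y - t‖ ^ 2) := by
      refine (pow_le_pow_left₀ (norm_nonneg _) hst 2).trans ?_
      nlinarith [sq_nonneg (‖x - s‖ - ‖x - y‖),
        sq_nonneg (‖x - s‖ - ‖y - t‖),
        sq_nonneg (‖x - y‖ - ‖y - t‖)]
    have := mul_le_mul_of_nonneg_left this (show 0 ≤ N by linarith)
    linarith
  refine ⟨N, x, y, s, t, p, q, A₁, A₂,
    by linarith, by linarith, by linarith, by linarith, ?_, ?_, by linarith, ?_, ?_,
    hj₁, hj₂, hA⟩
  · rw [show s - x₀ = -(x - s) + (x - x₀) by abel]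
    refine (norm_add_le _ _).trans ?_
    rw [norm_neg]
    linarith
  · rw [show t - x₀ = -(y - t) + -(x - y) + (x - x₀) by abel]
    refine (norm_add₃_le).trans ?_
    rw [norm_neg, norm_neg]
    linarith
  · have : ‖s - t‖ * ‖x - y‖ ≤
        1 / 2 * (‖s - t‖ ^ 2 + ‖x - y‖ ^ 2) := by
      nlinarith [sq_nonneg (‖s - t‖ - ‖x - y‖)]
    have := mul_le_mul_of_nonneg_left this (show 0 ≤ N by linarith)
    linarith
  · have t1 : ‖x₀‖ ≤ ‖x‖ + ‖x - x₀‖ := by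
      have := norm_sub_le (x) (x - x₀)
      rwa [sub_sub_cancel] at this
    have t2 : ‖x₀‖ ^ 2 ≤ ‖x‖ ^ 2 + 2 * ‖x₀‖ * ε₁ := by
      rcases le_total ‖x‖ ‖x₀‖ with h | h
      · nlinarith [norm_nonneg x₀, norm_nonneg (x)]
      · have := pow_le_pow_left₀ (norm_nonneg _) h 2
        have : 0 ≤ 2 * ‖x₀‖ * ε₁ := by positivity
        linarith
    have t3 : ε₁ * (2 * β * ‖x₀‖ + 1) ≤ ε / 2 := by
      have : ε₁ ≤ ε / (2 * (2 * β * ‖x₀‖ + 1)) := min_le_right _ _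
      rw [le_div_iff₀ (by positivity)] at this
      linarith
    have t4 := mul_le_mul_of_nonneg_left t2 hβ.le
    nlinarith

end DoublingLimit

section Comparison

variable {P : HJBData d d' M 𝒜} {Q : ImpulseData d M 𝒵} {C lam0 κ₀ : ℝ}

/-- The comparison inequality at a maximum point of `u i - v i - β ‖·‖²`. -/
lemma lam0_mul_le_of_isMax (h1 : H1 P C lam0) (h2 : H2 Q κ₀) {ρ : ℝ} (hρ : 0 ≤ ρ)
    {u v : Fin M → E d → ℝ} (hu : IsSubsolution (Fpen P Q ρ) u)
    (hv : IsSupersolution (Fpen P Q ρ) v) {B : ℝ} (hBu : ∀ i x, |u i x| ≤ B)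
    (hBv : ∀ i x, |v i x| ≤ B) {i : Fin M} {β m : ℝ} (hβ : 0 < β) {x₀ : E d}
    (hmax : ∀ x, u i x - v i x - β * ‖x‖ ^ 2 ≤ u i x₀ - v i x₀ - β * ‖x₀‖ ^ 2)
    (hm : ∀ j x, u j x - v j x ≤ m) (h0 : 0 < u i x₀ - v i x₀) :
    lam0 * (u i x₀ - v i x₀) ≤ 2 * β * C ^ 2 + 2 * C * (β * ‖x₀‖)
      + (M * C + ρ) * (m - (u i x₀ - v i x₀)) := by
  have hC := h1.C_nonneg i
  have hl0 := h1.1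
  have hB0 : 0 ≤ B := (abs_nonneg _).trans (hBu i 0)
  set a := u i x₀ - v i x₀ with ha
  have ham : a ≤ m := hm i x₀
  set K := lam0 + 3 * C ^ 2 + 4 * C + C * (4 * β + 2) + 3 * (M * C) + 2 * C * (1 + B + M * B)
    + 3 * ρ + 1 with hK
  suffices h : ∀ ε > 0, ε < 1 → ε < a → lam0 * a ≤ 2 * β * C ^ 2 + 2 * C * (β * ‖x₀‖)
      + (M * C + ρ) * (m - a) + ε * K by
    have ht : Tendsto (fun ε : ℝ => 2 * β * C ^ 2 + 2 * C * (β * ‖x₀‖)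
        + (M * C + ρ) * (m - a) + ε * K) (𝓝[>] 0) (𝓝 (2 * β * C ^ 2 + 2 * C * (β * ‖x₀‖)
        + (M * C + ρ) * (m - a) + 0 * K)) :=
      ((continuous_const.add (continuous_id.mul continuous_const)).tendsto _).mono_left
        nhdsWithin_le_nhds
    rw [zero_mul, add_zero] at ht
    refine ge_of_tendsto ht ?_
    filter_upwards [self_mem_nhdsWithin, nhdsWithin_le_nhds (gt_mem_nhds (zero_lt_one' ℝ)),
      nhdsWithin_le_nhds (gt_mem_nhds h0)] with ε e1 e2 e3
    exact h ε e1 e2 e3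
  intro ε hε hε1 hεa
  have hlowu : ∀ y, -B ≤ u i y := fun y => (abs_le.1 (hBu i y)).1
  have hlowv : ∀ y, -B ≤ v i y := fun y => (abs_le.1 (hBv i y)).1
  have hMusc := h2.upperSemicontinuous_Mop hlowu (hu.1 i)
  have hMlsc := h2.lowerSemicontinuous_Mop hlowv (hv.1 i)
  have ev₁ : ∀ᶠ s in 𝓝 x₀, (∀ j, u j s < u j x₀ + ε) ∧ Q.Mop i u s < Q.Mop i u x₀ + ε :=
    (eventually_all.2 fun j => hu.1 j x₀ _ (by linarith)).and (hMusc x₀ _ (by linarith))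
  have ev₂ : ∀ᶠ t in 𝓝 x₀, (∀ j, v j x₀ - ε < v j t) ∧ Q.Mop i v x₀ - ε < Q.Mop i v t :=
    (eventually_all.2 fun j => hv.1 j x₀ _ (by linarith)).and (hMlsc x₀ _ (by linarith))
  obtain ⟨r, hr, hball⟩ := Metric.eventually_nhds_iff.1 (ev₁.and ev₂)
  set ε' := min ε (r / 2) with hε'
  have hε'0 : 0 < ε' := by positivity
  have hε'ε : ε' ≤ ε := min_le_left _ _
  have hε'r : ε' < r := (min_le_right _ _).trans_lt (by linarith)
  obtain ⟨N, x, y, s, t, p, q, A₁, A₂, hN, hp, hq, hx, hs, ht, hst, hstx, hval, hj₁, hj₂, hA⟩ :=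
    exists_doubling_jets (hu.1 i) (hv.1 i).neg (hBu i)
      (fun x => by rw [Pi.neg_apply, abs_neg]; exact hBv i x) hβ (x₀ := x₀)
      (fun x => by simpa [← sub_eq_add_neg] using hmax x) hε'0
  simp only [Pi.neg_apply] at hval
  obtain ⟨hus, hMus⟩ := (hball (y := s) (by rw [dist_eq_norm]; linarith)).1
  obtain ⟨hvt, hMvt⟩ := (hball (y := t) (by rw [dist_eq_norm]; linarith)).2
  have hMx : Q.Mop i u x₀ ≤ Q.Mop i v x₀ + m :=
    h2.Mop_le_add hlowu (fun y => by linarith [hm i y]) x₀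
  have b1 : a - ε ≤ u i s - v i t := by rw [ha]; linarith
  have b2 : u i s - v i t ≤ a + 2 * ε := by linarith [hus i, hvt i]
  have hsn : ‖s - t‖ ≤ 2 * ε := by
    rw [show s - t = (s - x₀) - (t - x₀) by abel]
    refine (norm_sub_le _ _).trans ?_
    linarith
  set p₂ := (2 * N) • (x - y) - q with hp₂
  have key := lam0_mul_sub_le h1 hρ hu hv (p₂ := p₂) (η := ε) (θ := m - a + 3 * ε) (B := B)
    (m := m + 2 * ε) hN.le hβ.le hε (by linarith) hj₁ (by rw [hp₂, neg_sub]; exact hj₂) hA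
    (fun j => hBv j t) (fun j => by linarith [hus j, hvt j, hm j x₀]) (by linarith)
    (by linarith) (by linarith)
  have e1 : N * C ^ 2 * ‖s - t‖ ^ 2 ≤ C ^ 2 * ε := by
    have := mul_le_mul_of_nonneg_left (hst.trans hε'ε) (sq_nonneg C)
    linarith
  have e2 : C * ‖s - t‖ * ‖p₂‖ ≤ C * (4 * ε) := by
    have hpn : ‖p₂‖ ≤ 2 * N * ‖x - y‖ + 1 := by
      refine (norm_sub_le _ _).trans ?_
      rw [norm_smul, Real.norm_of_nonneg (by positivity)]
      linarith
    have := mul_le_mul_of_nonneg_left hpn (norm_nonneg (s - t))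
    rw [mul_assoc]
    refine mul_le_mul_of_nonneg_left ?_ hC
    linarith
  have hx0 : ‖x‖ ≤ ‖x₀‖ + ε := by
    have := norm_add_le x₀ (x - x₀)
    rw [add_sub_cancel] at this
    linarith
  have e3 : C * ‖(2 * N) • (x - y) + (2 * β) • x + (2 * β) • (x - x₀) + p - p₂‖ ≤
      C * (2 * β * ‖x₀‖ + 4 * β * ε + 2 * ε) := by
    refine mul_le_mul_of_nonneg_left ?_ hC
    rw [hp₂, show (2 * N) • (x - y) + (2 * β) • x + (2 * β) • (x - x₀) + p
      - ((2 * N) • (x - y) - q) = (2 * β) • x + (2 * β) • (x - x₀) + (p + q) by abel]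
    refine norm_add₃_le.trans ?_
    rw [norm_smul, norm_smul, Real.norm_of_nonneg (by positivity)]
    have := norm_add_le p q
    have := mul_le_mul_of_nonneg_left hx0 hβ.le
    have := mul_le_mul_of_nonneg_left (hx.trans hε'ε) hβ.le
    linarith
  have e4 : C * ‖s - t‖ * (1 + B + M * B) ≤ C * (2 * ε) * (1 + B + M * B) := by gcongr
  have e5 : ρ * (m + 2 * ε - (u i s - v i t)) ≤ ρ * (m - a + 3 * ε) :=
    mul_le_mul_of_nonneg_left (by linarith) hρ
  have e6 := mul_le_mul_of_nonneg_left b1 hl0.le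
  rw [hK]
  linarith

/-- Comparison principle for the penalized system. -/
lemma comparison (h1 : H1 P C lam0) (h2 : H2 Q κ₀) {ρ : ℝ} (hρ : 0 ≤ ρ)
    {u v : Fin M → E d → ℝ} (hbu : Bdd u) (hbv : Bdd v) (hu : IsSubsolution (Fpen P Q ρ) u)
    (hv : IsSupersolution (Fpen P Q ρ) v) (i₀ : Fin M) (z : E d) : u i₀ z ≤ v i₀ z := by
  have hC := h1.C_nonneg i₀
  have hl0 := h1.1
  obtain ⟨B₁, hB₁⟩ := hbu
  obtain ⟨B₂, hB₂⟩ := hbv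
  set B := max B₁ B₂
  have hBu : ∀ i x, |u i x| ≤ B := fun i x => (hB₁ i x).trans (le_max_left _ _)
  have hBv : ∀ i x, |v i x| ≤ B := fun i x => (hB₂ i x).trans (le_max_right _ _)
  have hB0 : 0 ≤ B := (abs_nonneg _).trans (hBu i₀ 0)
  have : Nonempty (Fin M × E d) := ⟨(i₀, z)⟩
  set m := ⨆ p : Fin M × E d, u p.1 p.2 - v p.1 p.2 with hmdef
  have hm : ∀ j x, u j x - v j x ≤ m := fun j x =>
    le_ciSup (f := fun p : Fin M × E d => u p.1 p.2 - v p.1 p.2) ⟨2 * B, by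
      rintro _ ⟨p, rfl⟩
      have := (abs_le.1 (hBu p.1 p.2)).2
      have := (abs_le.1 (hBv p.1 p.2)).1
      simp only
      linarith⟩ (j, x)
  suffices hm0 : m ≤ 0 by linarith [hm i₀ z]
  set K := 2 + 2 * lam0 + 2 * C ^ 2 + 3 * C + 2 * (M * C + ρ) with hK
  by_contra! hmpos
  suffices h : ∀ θ > 0, θ < 1 → 2 * θ < m → lam0 * m ≤ θ * K by
    have ht : Tendsto (fun θ : ℝ => θ * K) (𝓝[>] 0) (𝓝 (0 * K)) :=
      ((continuous_id.mul continuous_const).tendsto _).mono_left nhdsWithin_le_nhds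
    rw [zero_mul] at ht
    have : lam0 * m ≤ 0 := by
      refine ge_of_tendsto ht ?_
      filter_upwards [self_mem_nhdsWithin, nhdsWithin_le_nhds (gt_mem_nhds (zero_lt_one' ℝ)),
        nhdsWithin_le_nhds (gt_mem_nhds (half_pos hmpos))] with ε e1 e2 e3
      exact h ε e1 e2 (by linarith)
    linarith [mul_pos hl0 hmpos]
  intro θ hθ hθ1 hθm
  obtain ⟨⟨i, x₁⟩, hx₁⟩ := exists_lt_of_lt_ciSup (show m - θ < m by linarith)
  simp only at hx₁
  set β := θ / (1 + ‖x₁‖ ^ 2) with hβdef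
  have hβ : 0 < β := by positivity
  have hβθ : β ≤ θ := div_le_self hθ.le (by linarith [sq_nonneg ‖x₁‖])
  have hβx : β * ‖x₁‖ ^ 2 ≤ θ := by
    have : β * (1 + ‖x₁‖ ^ 2) = θ := by rw [hβdef]; field_simp
    linarith
  have husc : UpperSemicontinuous fun x => u i x - v i x - β * ‖x‖ ^ 2 := by
    have h3 : UpperSemicontinuous fun x : E d => -(β * ‖x‖ ^ 2) :=
      (by fun_prop : Continuous fun x : E d => -(β * ‖x‖ ^ 2)).upperSemicontinuous
    have := ((hu.1 i).add (hv.1 i).neg).add h3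
    simpa only [sub_eq_add_neg, Pi.neg_apply] using this
  obtain ⟨x₀, hmax⟩ := exists_forall_le_of_upperSemicontinuous husc x₁
    (1 + (m + 2 * B + θ) / β) fun x hx => by
      have h1 : (m + 2 * B + θ) / β ≤ ‖x‖ ^ 2 := by
        have : 0 ≤ (m + 2 * B + θ) / β := by positivity
        nlinarith
      rw [div_le_iff₀ hβ] at h1
      linarith [hm i x]
  have h3 := hmax x₁
  have hpen : 0 ≤ β * ‖x₀‖ ^ 2 := by positivity
  have ha : m - 2 * θ ≤ u i x₀ - v i x₀ := by linarith
  have hβx₀ : β * ‖x₀‖ ^ 2 ≤ 2 * θ := by linarith [hm i x₀]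
  have hlin : 2 * (β * ‖x₀‖) ≤ 3 * θ := by
    have := mul_nonneg hβ.le (sq_nonneg (‖x₀‖ - 1))
    linarith
  have key := lam0_mul_le_of_isMax h1 h2 hρ hu hv hBu hBv hβ hmax hm (by linarith)
  have e1 := mul_le_mul_of_nonneg_left ha hl0.le
  have e2 := mul_le_mul_of_nonneg_left hlin hC
  have e3 := mul_le_mul_of_nonneg_left hβθ (sq_nonneg C)
  have e4 : (M * C + ρ) * (m - (u i x₀ - v i x₀)) ≤ (M * C + ρ) * (2 * θ) :=
    mul_le_mul_of_nonneg_left (by linarith) (by positivity)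
  rw [hK]
  linarith

end Comparison

section Envelope

/-- Upper semicontinuous envelope of a bounded function. -/
def uscEnv (f : E d → ℝ) (x : E d) : ℝ := sInf {c | ∀ᶠ y in 𝓝 x, f y ≤ c}

variable {f : E d → ℝ} {B : ℝ}

lemma bddBelow_uscEnv (f : E d → ℝ) (x : E d) : BddBelow {c | ∀ᶠ y in 𝓝 x, f y ≤ c} :=
  ⟨f x, fun _ hc => hc.self_of_nhds⟩

lemma le_uscEnv (hf : ∀ y, f y ≤ B) (x : E d) : f x ≤ uscEnv f x :=
  le_csInf ⟨B, Eventually.of_forall hf⟩ fun _ hc => hc.self_of_nhds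

lemma uscEnv_le (hf : ∀ y, f y ≤ B) (x : E d) : uscEnv f x ≤ B :=
  csInf_le (bddBelow_uscEnv f x) (Eventually.of_forall hf)

lemma upperSemicontinuous_uscEnv (hf : ∀ y, f y ≤ B) : UpperSemicontinuous (uscEnv f) := by
  intro x c hc
  obtain ⟨c', hc', hlt⟩ := exists_lt_of_csInf_lt ⟨B, Eventually.of_forall hf⟩ hc
  filter_upwards [eventually_eventually_nhds.2 hc'] with y hy
  exact (csInf_le (bddBelow_uscEnv f y) hy).trans_lt hlt

lemma exists_lt_of_lt_uscEnv {x : E d} {c : ℝ} (h : c < uscEnv f x) {p : E d → Prop}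
    (hp : ∀ᶠ y in 𝓝 x, p y) : ∃ y, p y ∧ c < f y := by
  by_contra! H
  refine h.not_ge (csInf_le (bddBelow_uscEnv f x) ?_)
  filter_upwards [hp] with y hy
  exact H y hy

end Envelope

section Quartic

lemma contDiff_sub_quartic {φ : E d → ℝ} (hφ : ContDiff ℝ 2 φ) (a : ℝ) (x₀ : E d) :
    ContDiff ℝ 2 fun y => φ y - a * ‖y - x₀‖ ^ 4 := by
  have h : ContDiff ℝ 2 fun y : E d => (‖y - x₀‖ ^ 2) ^ 2 :=
    ((contDiff_id.sub contDiff_const).norm_sq ℝ).pow 2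
  refine hφ.sub (contDiff_const.mul ?_)
  simpa only [← pow_mul] using h

lemma isLocalMax_quartic_sub (a : ℝ) (x₀ : E d) {η : ℝ} (hη : 0 < η) :
    IsLocalMax (fun y => a * ‖y - x₀‖ ^ 4
      - quadTest 0 ((2 * η) • ContinuousLinearMap.id ℝ (E d)) x₀ y) x₀ := by
  have hc : Continuous fun y : E d => a * ‖y - x₀‖ ^ 2 := by fun_prop
  have h : ∀ᶠ y in 𝓝 x₀, a * ‖y - x₀‖ ^ 2 < η :=
    (hc.tendsto x₀).eventually (gt_mem_nhds (by simpa using hη))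
  filter_upwards [h] with y hy
  simp only [quadTest, inner_zero_left, sub_self, norm_zero, _root_.smul_apply,
    ContinuousLinearMap.id_apply, inner_smul_left, real_inner_self_eq_norm_sq, inner_zero_right,
    map_zero]
  have := mul_le_mul_of_nonneg_right hy.le (sq_nonneg ‖y - x₀‖)
  simp
  linarith

/-- A quartic perturbation does not change the second-order jet. -/
lemma jet_sub_quartic {φ : E d → ℝ} (hφ : ContDiff ℝ 2 φ) (a : ℝ) (x₀ : E d) :
    gradient (fun y => φ y - a * ‖y - x₀‖ ^ 4) x₀ = gradient φ x₀ ∧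
    ∀ v, secondDeriv (fun y => φ y - a * ‖y - x₀‖ ^ 4) x₀ v = secondDeriv φ x₀ v := by
  have hq : ∀ a : ℝ, ContDiff ℝ 2 fun y : E d => a * ‖y - x₀‖ ^ 4 := fun a => by
    have := contDiff_sub_quartic (φ := fun _ => 0) contDiff_const (-a) x₀
    simpa using this
  have key : ∀ (a : ℝ), ∀ η > 0, gradient (fun y => a * ‖y - x₀‖ ^ 4) x₀ = 0 ∧
      ∀ v, secondDeriv (fun y => a * ‖y - x₀‖ ^ 4) x₀ v ≤ 2 * η * ‖v‖ ^ 2 := fun a η hη => by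
    have := gradient_eq_and_secondDeriv_le (hq a) (contDiff_quadTest _ _ _)
      (isLocalMax_quartic_sub a x₀ hη)
    simpa [gradient_quadTest, secondDeriv_quadTest, inner_smul_left] using this
  have hle : ∀ (a : ℝ) v, secondDeriv (fun y => a * ‖y - x₀‖ ^ 4) x₀ v ≤ 0 := fun a v => by
    have ht : Tendsto (fun η : ℝ => 2 * η * ‖v‖ ^ 2) (𝓝[>] 0) (𝓝 (2 * 0 * ‖v‖ ^ 2)) :=
      ((by fun_prop : Continuous fun η : ℝ => 2 * η * ‖v‖ ^ 2).tendsto _).mono_left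
        nhdsWithin_le_nhds
    rw [mul_zero, zero_mul] at ht
    refine ge_of_tendsto ht ?_
    filter_upwards [self_mem_nhdsWithin] with η hη
    exact (key a η hη).2 v
  have hz : ∀ v, secondDeriv (fun y => a * ‖y - x₀‖ ^ 4) x₀ v = 0 := fun v => by
    refine le_antisymm (hle a v) ?_
    have h1 := hle (-a) v
    have h2 := secondDeriv_sub (contDiff_const (c := (0 : ℝ))) (hq a) x₀ v
    have h3 : secondDeriv (fun _ : E d => (0 : ℝ)) x₀ v = 0 := by simp [secondDeriv]
    rw [show (fun y : E d => (0 : ℝ) - a * ‖y - x₀‖ ^ 4) = fun y => -a * ‖y - x₀‖ ^ 4 from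
      funext fun y => by ring] at h2
    linarith
  refine ⟨?_, fun v => ?_⟩
  · rw [gradient_sub hφ (hq a), (key a 1 one_pos).1, sub_zero]
  · rw [secondDeriv_sub hφ (hq a), hz, sub_zero]

end Quartic

section Perron

variable {P : HJBData d d' M 𝒜} {Q : ImpulseData d M 𝒵} {C lam0 κ₀ : ℝ}

/-- Degenerate ellipticity and monotonicity of the Hamiltonian, for Hessians of functions. -/
lemma H1.Ham_hess_le (h1 : H1 P C lam0) {i : Fin M} {x : E d} {s s' : Fin M → ℝ} {p : E d}
    {φ ψ : E d → ℝ} (hi : s i = s' i) (hs : ∀ j, s' j ≤ s j)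
    (h : ∀ v, secondDeriv ψ x v ≤ secondDeriv φ x v) :
    P.Ham i x s p (hess φ x) ≤ P.Ham i x s' p (hess ψ x) := by
  refine h1.Ham_le_Ham hi hs fun σ => ?_
  rw [trace_mul_hess, trace_mul_hess]
  gcongr
  exact h _

lemma H1.Ham_sub_quartic (h1 : H1 P C lam0) {i : Fin M} {s : Fin M → ℝ} {φ : E d → ℝ}
    (hφ : ContDiff ℝ 2 φ) (a : ℝ) (x₀ : E d) :
    P.Ham i x₀ s (gradient (fun y => φ y - a * ‖y - x₀‖ ^ 4) x₀)
      (hess (fun y => φ y - a * ‖y - x₀‖ ^ 4) x₀) =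
    P.Ham i x₀ s (gradient φ x₀) (hess φ x₀) := by
  obtain ⟨hg, hh⟩ := jet_sub_quartic hφ a x₀
  rw [hg]
  exact le_antisymm (h1.Ham_hess_le rfl (fun _ => le_rfl) fun v => (hh v).ge)
    (h1.Ham_hess_le rfl (fun _ => le_rfl) fun v => (hh v).le)

/-- Continuity of the penalized operator along a fixed test function. -/
lemma H1.exists_forall_Ham_mem (h1 : H1 P C lam0) {i : Fin M} {ψ : E d → ℝ} (hψ : ContDiff ℝ 2 ψ)
    {ρ : ℝ} {x₀ : E d} {S : Fin M → ℝ} {a : ℝ} {O : Set ℝ} (hO : IsOpen O)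
    (h : P.Ham i x₀ S (gradient ψ x₀) (hess ψ x₀) + ρ * max a 0 ∈ O) :
    ∃ δ > 0, ∀ (y : E d) (s : Fin M → ℝ) (b : ℝ), ‖y - x₀‖ < δ → (∀ j, |s j - S j| < δ) →
      |b - a| < δ → P.Ham i y s (gradient ψ y) (hess ψ y) + ρ * max b 0 ∈ O := by
  have hg := continuous_gradient hψ
  have hh := continuous_hess hψ
  have hz : Continuous fun z : E d × (Fin M → ℝ) × ℝ =>
      (z.1, z.2.1, gradient ψ z.1, hess ψ z.1) :=
    continuous_fst.prodMk (continuous_snd.fst.prodMk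
      ((hg.comp continuous_fst).prodMk (hh.comp continuous_fst)))
  have hc : Continuous fun z : E d × (Fin M → ℝ) × ℝ =>
      P.Ham i z.1 z.2.1 (gradient ψ z.1) (hess ψ z.1) + ρ * max z.2.2 0 :=
    ((h1.continuous_Ham i).comp hz).add
      (continuous_const.mul (continuous_snd.snd.max continuous_const))
  obtain ⟨δ, hδ, hball⟩ := Metric.eventually_nhds_iff.1
    ((hc.tendsto (x₀, S, a)).eventually (hO.mem_nhds h))
  refine ⟨δ, hδ, fun y s b hy hs hb => hball (y := (y, s, b)) ?_⟩
  rw [Prod.dist_eq, Prod.dist_eq]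
  refine max_lt (by rwa [dist_eq_norm]) (max_lt ((dist_pi_lt_iff hδ).2 fun j => ?_) ?_)
  · rw [Real.dist_eq]; exact hs j
  · rw [Real.dist_eq]; exact hb

/-- The upper envelope of a pointwise supremum of bounded subsolutions is a subsolution. -/
lemma isSubsolution_uscEnv (h1 : H1 P C lam0) (h2 : H2 Q κ₀) {ρ B : ℝ} (hρ : 0 ≤ ρ)
    {S : Set (Fin M → E d → ℝ)} (hS : ∀ u ∈ S, IsSubsolution (Fpen P Q ρ) u)
    (hSB : ∀ u ∈ S, ∀ i x, -B ≤ u i x) {w : Fin M → E d → ℝ} (hwB : ∀ i x, w i x ≤ B)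
    (hle : ∀ u ∈ S, ∀ i x, u i x ≤ w i x) (hex : ∀ i x c, c < w i x → ∃ u ∈ S, c < u i x) :
    IsSubsolution (Fpen P Q ρ) fun i => uscEnv (w i) := by
  set W : Fin M → E d → ℝ := fun i => uscEnv (w i) with hW
  have hWusc : ∀ i, UpperSemicontinuous (W i) := fun i => upperSemicontinuous_uscEnv (hwB i)
  have hwW : ∀ i x, w i x ≤ W i x := fun i x => le_uscEnv (hwB i) x
  refine ⟨hWusc, fun i φ hφ x₀ hx₀ => ?_⟩
  set ψ : E d → ℝ := fun y => φ y - (-1) * ‖y - x₀‖ ^ 4 with hψdef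
  have hψ : ContDiff ℝ 2 ψ := contDiff_sub_quartic hφ _ _
  by_contra! hpos
  simp only [Fpen] at hpos
  rw [← h1.Ham_sub_quartic hφ (-1) x₀] at hpos
  obtain ⟨δ, hδ, hG⟩ := h1.exists_forall_Ham_mem hψ (isOpen_Ioi (a := (0 : ℝ))) hpos
  have hlowW : ∀ y, -B ≤ W i y := fun y => by
    by_contra! H
    obtain ⟨u, hu, -⟩ := hex i y (w i y - 1) (by linarith)
    linarith [hSB u hu i y, hle u hu i y, hwW i y]
  have hev := (((hx₀.and (eventually_all.2 fun j => hWusc j x₀ (W j x₀ + δ / 4) (by linarith))).and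
    (h2.upperSemicontinuous_Mop hlowW (hWusc i) x₀ (Q.Mop i W x₀ + δ / 4) (by linarith))).and
    ((hψ.continuous.tendsto x₀).eventually
      (Metric.ball_mem_nhds (ψ x₀) (by positivity : 0 < δ / 8))))
  obtain ⟨r₀, hr₀, hball⟩ := Metric.eventually_nhds_iff.1 hev
  set r := min (r₀ / 2) (δ / 2) with hr
  have hr0 : 0 < r := by positivity
  have hrr : r < r₀ := (min_le_left _ _).trans_lt (by linarith)
  have hrδ : r < δ := (min_le_right _ _).trans_lt (by linarith)
  set τ := min (δ / 16) (r ^ 4 / 4) with hτ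
  have hτ0 : 0 < τ := by positivity
  have hτ1 : τ ≤ δ / 16 := min_le_left _ _
  have hτ2 : τ ≤ r ^ 4 / 4 := min_le_right _ _
  have hψev := (hψ.continuous.tendsto x₀).eventually (Metric.ball_mem_nhds (ψ x₀) hτ0)
  have hr_ev : ∀ᶠ y in 𝓝 x₀, y ∈ Metric.ball x₀ r := Metric.ball_mem_nhds x₀ hr0
  obtain ⟨z, ⟨hz1, hz2⟩, hz3⟩ := exists_lt_of_lt_uscEnv (f := w i) (x := x₀) (c := W i x₀ - τ)
    (sub_lt_self _ hτ0) (hr_ev.and hψev)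
  obtain ⟨u, hu, huz⟩ := hex i z _ hz3
  have husub := hS u hu
  have hcont : UpperSemicontinuous fun y => u i y - ψ y := by
    simpa only [sub_eq_add_neg, Pi.neg_apply] using
      (husub.1 i).add hψ.continuous.neg.upperSemicontinuous
  obtain ⟨y, hy, hymax⟩ := UpperSemicontinuousOn.exists_isMaxOn
    (s := Metric.closedBall x₀ r) ⟨x₀, by simp [hr0.le]⟩
    (isCompact_closedBall _ _) (hcont.upperSemicontinuousOn _)
  rw [Metric.mem_closedBall, dist_eq_norm] at hy
  have hymax' := hymax (Metric.ball_subset_closedBall hz1)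
  simp only [Set.mem_ofPred_eq] at hymax'
  rw [Real.dist_eq, abs_lt] at hz2
  obtain ⟨⟨⟨hmaxy, hWy⟩, hMy⟩, hψy⟩ := hball (y := y) (by rw [dist_eq_norm]; linarith)
  rw [Real.dist_eq, abs_lt] at hψy
  have huW : ∀ j y, u j y ≤ W j y := fun j y => (hle u hu j y).trans (hwW j y)
  have hψφ : ∀ y, ψ y = φ y + ‖y - x₀‖ ^ 4 := fun y => by simp only [hψdef]; ring
  have hψ0 : ψ x₀ = φ x₀ := by rw [hψφ]; simp
  have h4 : ‖y - x₀‖ ^ 4 < r ^ 4 := by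
    have := huW i y
    have := hψφ y
    linarith [pow_pos hr0 4]
  have hyr : ‖y - x₀‖ < r := lt_of_pow_lt_pow_left₀ 4 hr0.le h4
  have hloc : IsLocalMax (fun y => u i y - ψ y) y :=
    hymax.isLocalMax (Filter.mem_of_superset (Metric.isOpen_ball.mem_nhds
      (by rw [Metric.mem_ball, dist_eq_norm]; exact hyr)) Metric.ball_subset_closedBall)
  have hF := husub.2 i ψ hψ y hloc
  simp only [Fpen] at hF
  have hlow : W i x₀ - δ / 4 ≤ u i y := by linarith
  have hM : Q.Mop i u y ≤ Q.Mop i W y := h2.Mop_mono (hSB u hu i) (huW i) y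
  set s : Fin M → ℝ := Function.update (fun j => W j x₀ + δ / 4) i (u i y) with hs
  have hHam : P.Ham i y s (gradient ψ y) (hess ψ y) ≤
      P.Ham i y (fun j => u j y) (gradient ψ y) (hess ψ y) := by
    refine h1.Ham_hess_le (by simp [hs]) (fun j => ?_) fun v => le_rfl
    by_cases hj : j = i
    · subst hj; simp [hs]
    · simp only [hs, Function.update_of_ne hj]
      linarith [huW j y, hWy j]
  have hpen : max (W i x₀ - Q.Mop i W x₀ - δ / 2) 0 ≤ max (u i y - Q.Mop i u y) 0 :=
    max_le_max_right _ (by linarith)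
  have := hG y s (W i x₀ - Q.Mop i W x₀ - δ / 2) (by linarith) (fun j => by
    by_cases hj : j = i
    · subst hj
      simp only [hs, Function.update_self]
      rw [abs_lt]
      constructor <;> linarith [huW j y, hWy j]
    · simp only [hs, Function.update_of_ne hj]
      rw [abs_lt]
      constructor <;> linarith) (by rw [abs_lt]; constructor <;> linarith)
  rw [Set.mem_Ioi] at this
  have := mul_le_mul_of_nonneg_left hpen hρ
  linarith

end Perron

section Perron

variable {P : HJBData d d' M 𝒜} {Q : ImpulseData d M 𝒵} {C lam0 κ₀ : ℝ}

/-- Raising a subsolution without changing the active component decreases the operator. -/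
lemma Fpen_le_Fpen (h1 : H1 P C lam0) (h2 : H2 Q κ₀) {ρ B : ℝ} (hρ : 0 ≤ ρ)
    {u v : Fin M → E d → ℝ} {i : Fin M} (hu : ∀ y, -B ≤ u i y) (huv : ∀ j y, u j y ≤ v j y)
    {x p : E d} {X : Matrix (Fin d) (Fin d) ℝ} (hx : u i x = v i x) :
    Fpen P Q ρ i x v p X ≤ Fpen P Q ρ i x u p X := by
  simp only [Fpen]
  refine add_le_add (h1.Ham_le_Ham hx.symm (fun j => huv j x) fun _ => le_rfl)
    (mul_le_mul_of_nonneg_left (max_le_max_right _ ?_) hρ)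
  have := h2.Mop_mono hu (huv i) x
  linarith

/-- Replacing one component by its maximum with a function `b` on a ball. -/
def bump (W : Fin M → E d → ℝ) (i : Fin M) (x₀ : E d) (r : ℝ) (b : E d → ℝ) :
    Fin M → E d → ℝ :=
  Function.update W i fun y => if ‖y - x₀‖ < r then max (W i y) (b y) else W i y

section bump

variable {W : Fin M → E d → ℝ} {i : Fin M} {x₀ : E d} {r : ℝ} {b : E d → ℝ}

lemma bump_of_ne {j : Fin M} (hj : j ≠ i) : bump W i x₀ r b j = W j := by
  simp [bump, hj]

lemma bump_of_lt {y : E d} (hy : ‖y - x₀‖ < r) : bump W i x₀ r b i y = max (W i y) (b y) := by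
  simp [bump, hy]

lemma bump_of_le {r' : ℝ} (hb : ∀ y, r' ≤ ‖y - x₀‖ → ‖y - x₀‖ < r → b y ≤ W i y) {y : E d}
    (hy : r' ≤ ‖y - x₀‖) : bump W i x₀ r b i y = W i y := by
  by_cases h : ‖y - x₀‖ < r
  · rw [bump_of_lt h, max_eq_left (hb y hy h)]
  · simp [bump, h]

lemma le_bump (j : Fin M) (y : E d) : W j y ≤ bump W i x₀ r b j y := by
  by_cases hj : j = i
  · subst hj
    by_cases h : ‖y - x₀‖ < r
    · rw [bump_of_lt h]; exact le_max_left _ _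
    · simp [bump, h]
  · rw [bump_of_ne hj]

lemma bump_le {c : ℝ} (hW : ∀ j y, W j y ≤ c) (hb : ∀ y, ‖y - x₀‖ < r → b y ≤ c) (j : Fin M)
    (y : E d) : bump W i x₀ r b j y ≤ c := by
  by_cases hj : j = i
  · subst hj
    by_cases h : ‖y - x₀‖ < r
    · rw [bump_of_lt h]; exact max_le (hW _ _) (hb y h)
    · simpa [bump, h] using hW _ _
  · rw [bump_of_ne hj]; exact hW _ _

lemma upperSemicontinuous_bump (hW : ∀ j, UpperSemicontinuous (W j)) (hbc : Continuous b) {r' : ℝ}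
    (hr : r' < r) (hb : ∀ y, r' ≤ ‖y - x₀‖ → ‖y - x₀‖ < r → b y ≤ W i y) (j : Fin M) :
    UpperSemicontinuous (bump W i x₀ r b j) := by
  by_cases hj : j = i
  · subst hj
    intro y
    have hn : Continuous fun z : E d => ‖z - x₀‖ := by fun_prop
    rcases lt_or_ge ‖y - x₀‖ r with h | h
    · intro c hc
      rw [bump_of_lt h, max_lt_iff] at hc
      filter_upwards [(hn.tendsto y).eventually (gt_mem_nhds h), hW j y c hc.1,
        hbc.upperSemicontinuous y c hc.2] with z z1 z2 z3
      rw [bump_of_lt z1]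
      exact max_lt z2 z3
    · intro c hc
      rw [bump_of_le hb (hr.le.trans h)] at hc
      filter_upwards [(hn.tendsto y).eventually (lt_mem_nhds (hr.trans_le h)),
        hW j y c hc] with z z1 z2
      rwa [bump_of_le hb (le_of_lt z1)]
  · rw [bump_of_ne hj]; exact hW j

end bump

/-- Bumping up a subsolution by a strict local subsolution gives a subsolution. -/
lemma isSubsolution_bump (h1 : H1 P C lam0) (h2 : H2 Q κ₀) {ρ B : ℝ} (hρ : 0 ≤ ρ)
    {W : Fin M → E d → ℝ} (hW : IsSubsolution (Fpen P Q ρ) W) (hWB : ∀ i x, -B ≤ W i x)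
    {i : Fin M} {x₀ : E d} {r r' : ℝ} (hr : r' < r) {b : E d → ℝ} (hbC : ContDiff ℝ 2 b)
    (hb : ∀ y, r' ≤ ‖y - x₀‖ → ‖y - x₀‖ < r → b y ≤ W i y)
    (hF : ∀ y, ‖y - x₀‖ < r →
      Fpen P Q ρ i y (bump W i x₀ r b) (gradient b y) (hess b y) ≤ 0 ∨ b y ≤ W i y) :
    IsSubsolution (Fpen P Q ρ) (bump W i x₀ r b) := by
  refine ⟨upperSemicontinuous_bump hW.1 hbC.continuous hr hb, fun k χ hχ y hy => ?_⟩
  by_cases hk : bump W i x₀ r b k y = W k y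
  · refine (Fpen_le_Fpen h1 h2 hρ (hWB k) le_bump hk.symm).trans (hW.2 k χ hχ y ?_)
    filter_upwards [hy] with z hz
    rw [hk] at hz
    linarith [le_bump (W := W) (i := i) (x₀ := x₀) (r := r) (b := b) k z]
  · obtain rfl : k = i := by
      by_contra H
      exact hk (by rw [bump_of_ne H])
    have hyr : ‖y - x₀‖ < r := by
      by_contra! H
      exact hk (bump_of_le hb (hr.le.trans H))
    rw [bump_of_lt hyr] at hk
    have hlt : W k y < b y := by
      by_contra! H
      exact hk (max_eq_left H)
    have hUy : bump W k x₀ r b k y = b y := by rw [bump_of_lt hyr, max_eq_right hlt.le]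
    have hloc : IsLocalMax (fun z => b z - χ z) y := by
      have hn : Continuous fun z : E d => ‖z - x₀‖ := by fun_prop
      filter_upwards [hy, (hn.tendsto y).eventually (gt_mem_nhds hyr)] with z hz hzr
      rw [hUy, bump_of_lt hzr] at hz
      linarith [le_max_right (W k z) (b z)]
    obtain ⟨hg, hh⟩ := gradient_eq_and_secondDeriv_le hbC hχ hloc
    refine le_trans ?_ ((hF y hyr).resolve_right hlt.not_ge)
    simp only [Fpen]
    rw [← hg]
    gcongr
    exact h1.Ham_hess_le rfl (fun _ => le_rfl) hh

lemma lowerSemicontinuous_neg_uscEnv {f : E d → ℝ} {B : ℝ} (hf : ∀ y, -B ≤ f y) :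
    LowerSemicontinuous fun x => -uscEnv (fun y => -f y) x :=
  (upperSemicontinuous_uscEnv (B := B) fun y => by linarith [hf y]).neg

/-- The lower envelope of the maximal bounded subsolution is a supersolution. -/
lemma isSupersolution_lscEnv (h1 : H1 P C lam0) (h2 : H2 Q κ₀) {ρ B : ℝ} (hρ : 0 ≤ ρ)
    {W : Fin M → E d → ℝ} (hW : IsSubsolution (Fpen P Q ρ) W) (hWB : ∀ i x, |W i x| ≤ B)
    (hmax : ∀ U, Bdd U → IsSubsolution (Fpen P Q ρ) U → (∀ i x, W i x ≤ U i x) →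
      ∀ i x, U i x ≤ W i x) :
    IsSupersolution (Fpen P Q ρ) fun i x => -uscEnv (fun y => -W i y) x := by
  set V : Fin M → E d → ℝ := fun i x => -uscEnv (fun y => -W i y) x with hV
  have hlow : ∀ i y, -B ≤ W i y := fun i y => (abs_le.1 (hWB i y)).1
  have hlowV : ∀ i y, -B ≤ V i y := fun i y =>
    neg_le_neg (uscEnv_le (fun z => by linarith [hlow i z]) y)
  have hVlsc : ∀ i, LowerSemicontinuous (V i) := fun i => lowerSemicontinuous_neg_uscEnv (hlow i)
  have hVW : ∀ i x, V i x ≤ W i x := fun i x => by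
    have := le_uscEnv (f := fun y => -W i y) (B := B) (fun z => by linarith [hlow i z]) x
    simp only [hV]
    linarith
  refine ⟨hVlsc, fun i φ hφ x₀ hx₀ => ?_⟩
  by_contra! hneg
  simp only [Fpen] at hneg
  rw [← h1.Ham_sub_quartic hφ 1 x₀] at hneg
  set ψ : E d → ℝ := fun y => φ y - 1 * ‖y - x₀‖ ^ 4 with hψdef
  have hψ : ContDiff ℝ 2 ψ := contDiff_sub_quartic hφ _ _
  obtain ⟨δ, hδ, hG⟩ := h1.exists_forall_Ham_mem hψ (isOpen_Iio (a := (0 : ℝ))) hneg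
  have hev := (((hx₀.and (eventually_all.2 fun j => hVlsc j x₀ (V j x₀ - δ / 4) (by linarith))).and
    (h2.lowerSemicontinuous_Mop (hlowV i) (hVlsc i) x₀ (Q.Mop i V x₀ - δ / 4) (by linarith))).and
    ((hψ.continuous.tendsto x₀).eventually
      (Metric.ball_mem_nhds (ψ x₀) (by positivity : 0 < δ / 8))))
  obtain ⟨r₀, hr₀, hball⟩ := Metric.eventually_nhds_iff.1 hev
  set r := min r₀ δ with hr
  have hr0 : 0 < r := by positivity
  have hrr : r ≤ r₀ := min_le_left _ _
  have hrδ : r ≤ δ := min_le_right _ _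
  set τ := min (δ / 8) ((r / 2) ^ 4) with hτ
  have hτ0 : 0 < τ := by positivity
  have hτ1 : τ ≤ δ / 8 := min_le_left _ _
  have hτ2 : τ ≤ (r / 2) ^ 4 := min_le_right _ _
  set c := V i x₀ - ψ x₀ + τ with hc
  set b : E d → ℝ := fun y => ψ y - -c with hbdef
  have hbC : ContDiff ℝ 2 b := hψ.sub contDiff_const
  have hgb : ∀ y, gradient b y = gradient ψ y := fun y => by
    rw [hbdef, gradient_sub hψ contDiff_const]
    simp [gradient]
  have hhb : ∀ y v, secondDeriv b y v = secondDeriv ψ y v := fun y v => by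
    rw [hbdef, secondDeriv_sub hψ contDiff_const]
    simp [secondDeriv]
  have hψφ : ∀ y, ψ y = φ y - ‖y - x₀‖ ^ 4 := fun y => by simp only [hψdef]; ring
  have hψ0 : ψ x₀ = φ x₀ := by rw [hψφ]; simp
  have hbW : ∀ y, r / 2 ≤ ‖y - x₀‖ → ‖y - x₀‖ < r → b y ≤ W i y := fun y hy hyr => by
    obtain ⟨⟨⟨hmin, -⟩, -⟩, -⟩ := hball (y := y) (by rw [dist_eq_norm]; linarith)
    have h4 : (r / 2) ^ 4 ≤ ‖y - x₀‖ ^ 4 := pow_le_pow_left₀ (by positivity) hy 4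
    have := hψφ y
    have := hVW i y
    simp only [hbdef, hc]
    linarith
  set U := bump W i x₀ r b with hU
  have hVU : ∀ j y, V j y ≤ U j y := fun j y => (hVW j y).trans (le_bump j y)
  have hUsub : IsSubsolution (Fpen P Q ρ) U := by
    refine isSubsolution_bump h1 h2 hρ hW hlow (by linarith) hbC hbW fun y hyr => ?_
    by_cases hbWy : b y ≤ W i y
    · exact Or.inr hbWy
    left
    obtain ⟨⟨⟨-, hVy⟩, hMy⟩, hψy⟩ := hball (y := y) (by rw [dist_eq_norm]; linarith)
    rw [Real.dist_eq, abs_lt] at hψy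
    have hUy : U i y = b y := by rw [hU, bump_of_lt hyr, max_eq_right (le_of_not_ge hbWy)]
    have hb : b y = ψ y - ψ x₀ + V i x₀ + τ := by simp only [hbdef, hc]; ring
    have hM : Q.Mop i V y ≤ Q.Mop i U y := h2.Mop_mono (hlowV i) (hVU i) y
    set s : Fin M → ℝ := Function.update (fun j => V j x₀ - δ / 4) i (b y) with hs
    have hHam : P.Ham i y (fun j => U j y) (gradient b y) (hess b y) ≤
        P.Ham i y s (gradient ψ y) (hess ψ y) := by
      rw [hgb]
      refine h1.Ham_hess_le (by simp [hs, hUy]) (fun j => ?_) fun v => (hhb y v).ge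
      by_cases hj : j = i
      · subst hj; simp [hs, hUy]
      · simp only [hs, Function.update_of_ne hj]
        linarith [hVU j y, hVy j]
    have hpen : max (U i y - Q.Mop i U y) 0 ≤ max (V i x₀ - Q.Mop i V x₀ + δ / 2) 0 :=
      max_le_max_right _ (by linarith)
    have := hG y s (V i x₀ - Q.Mop i V x₀ + δ / 2) (by linarith) (fun j => by
      by_cases hj : j = i
      · subst hj
        simp only [hs, Function.update_self]
        rw [abs_lt]
        constructor <;> linarith
      · simp only [hs, Function.update_of_ne hj]
        rw [abs_lt]
        constructor <;> linarith) (by rw [abs_lt]; constructor <;> linarith)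
    rw [Set.mem_Iio] at this
    have := mul_le_mul_of_nonneg_left hpen hρ
    simp only [Fpen]
    linarith
  have hUB : Bdd U := by
    set c' := max B (V i x₀ + δ) with hc'
    have hup : ∀ j y, U j y ≤ c' :=
      bump_le (fun j y => ((abs_le.1 (hWB j y)).2).trans (le_max_left _ _)) fun y hyr => by
        obtain ⟨-, hψy⟩ := hball (y := y) (by rw [dist_eq_norm]; linarith)
        rw [Real.dist_eq, abs_lt] at hψy
        refine le_trans ?_ (le_max_right _ _)
        simp only [hbdef, hc]
        linarith
    refine ⟨c', fun j y => abs_le.2 ⟨?_, hup j y⟩⟩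
    linarith [le_bump (W := W) (i := i) (x₀ := x₀) (r := r) (b := b) j y, hlow j y,
      le_max_left B (V i x₀ + δ)]
  have hr_ev : ∀ᶠ y in 𝓝 x₀, y ∈ Metric.ball x₀ r := Metric.ball_mem_nhds x₀ hr0
  have hψev := (hψ.continuous.tendsto x₀).eventually (Metric.ball_mem_nhds (ψ x₀) (half_pos hτ0))
  obtain ⟨z, ⟨hz1, hz2⟩, hz3⟩ := exists_lt_of_lt_uscEnv (f := fun y => -W i y) (x := x₀)
    (c := -(V i x₀ + τ / 2)) (by simp only [hV]; linarith) (hr_ev.and hψev)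
  rw [Metric.mem_ball, dist_eq_norm] at hz1
  rw [Real.dist_eq, abs_lt] at hz2
  have h3 := hmax U hUB hUsub (fun j y => le_bump j y) i z
  rw [hU, bump_of_lt hz1] at h3
  have h4 := (le_max_right (W i z) (b z)).trans h3
  simp only [hbdef, hc] at h4
  linarith

lemma isSubsolution_const (h1 : H1 P C lam0) (h2 : H2 Q κ₀) {ρ : ℝ} :
    IsSubsolution (Fpen P Q ρ) fun _ _ => -(|C| / lam0) := by
  have hl0 := h1.1
  have hC0 : 0 ≤ |C| / lam0 := by positivity
  refine ⟨fun i => upperSemicontinuous_const, fun i φ hφ x hx => ?_⟩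
  obtain ⟨hg, hh⟩ := gradient_eq_and_secondDeriv_le contDiff_const hφ hx
  have hg0 : gradient φ x = 0 := by rw [← hg]; simp [gradient]
  have hh0 : ∀ v, 0 ≤ secondDeriv φ x v := fun v => by
    refine le_trans (le_of_eq ?_) (hh v)
    simp [secondDeriv]
  have hM := h2.const_le_Mop (u := fun _ _ => -(|C| / lam0)) (i := i) (fun _ => le_rfl) x
  simp only [Fpen]
  rw [max_eq_right (by linarith), mul_zero, add_zero]
  refine h1.Ham_le fun α hα => ?_
  obtain ⟨-, -, -, -, -, -, -, -, -, -, -, hl, -, -, -, hcd⟩ := h1.2.2 i α hα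
  have e1 : 0 ≤ Matrix.trace (((1 : ℝ) / 2) • (P.σm i α x * (P.σm i α x)ᵀ) * hess φ x) := by
    rw [trace_mul_hess]
    exact mul_nonneg (by norm_num) (Finset.sum_nonneg fun l _ => hh0 _)
  have e2 := mul_le_mul_of_nonneg_right (hcd x) hC0
  rw [mul_div_cancel₀ _ hl0.ne'] at e2
  have e3 := (abs_le.1 (hl x)).1
  have e4 := le_abs_self C
  simp only [HJBData.L, hg0, inner_zero_right, ← Finset.sum_mul]
  linarith

lemma isSupersolution_const (h1 : H1 P C lam0) {ρ : ℝ} (hρ : 0 ≤ ρ) :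
    IsSupersolution (Fpen P Q ρ) fun _ _ => |C| / lam0 := by
  have hl0 := h1.1
  have hC0 : 0 ≤ |C| / lam0 := by positivity
  refine ⟨fun i => lowerSemicontinuous_const, fun i φ hφ x hx => ?_⟩
  have hx' : IsLocalMax (fun y => φ y - |C| / lam0) x := by
    filter_upwards [hx] with y hy
    linarith
  obtain ⟨hg, hh⟩ := gradient_eq_and_secondDeriv_le hφ contDiff_const hx'
  have hg0 : gradient φ x = 0 := by rw [hg]; simp [gradient]
  have hh0 : ∀ v, secondDeriv φ x v ≤ 0 := fun v => by
    refine (hh v).trans (le_of_eq ?_)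
    simp [secondDeriv]
  obtain ⟨α, hα⟩ := (h1.2.1 i).1
  simp only [Fpen]
  refine add_nonneg (le_trans ?_ (h1.L_le_Ham hα _ _ _ _))
    (mul_nonneg hρ (le_max_right _ _))
  obtain ⟨-, -, -, -, -, -, -, -, -, -, -, hl, -, -, -, hcd⟩ := h1.2.2 i α hα
  have e1 : Matrix.trace (((1 : ℝ) / 2) • (P.σm i α x * (P.σm i α x)ᵀ) * hess φ x) ≤ 0 := by
    rw [trace_mul_hess]
    exact mul_nonpos_of_nonneg_of_nonpos (by norm_num) (Finset.sum_nonpos fun l _ => hh0 _)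
  have e2 := mul_le_mul_of_nonneg_right (hcd x) hC0
  rw [mul_div_cancel₀ _ hl0.ne'] at e2
  have e3 := (abs_le.1 (hl x)).2
  have e4 := le_abs_self C
  simp only [HJBData.L, hg0, inner_zero_right, ← Finset.sum_mul]
  linarith

/-- Perron's method for the penalized system. -/
lemma exists_isSolution (h1 : H1 P C lam0) (h2 : H2 Q κ₀) {ρ : ℝ} (hρ : 0 ≤ ρ) :
    ∃ w : Fin M → E d → ℝ, IsSolution (Fpen P Q ρ) w ∧ ∀ i x, |w i x| ≤ |C| / lam0 := by
  have hC0 : 0 ≤ |C| / lam0 := div_nonneg (abs_nonneg _) h1.1.le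
  set B := |C| / lam0 with hBdef
  have hsup := isSupersolution_const (Q := Q) h1 hρ
  have hsub := isSubsolution_const h1 h2 (ρ := ρ)
  have hbB : Bdd (fun (_ : Fin M) (_ : E d) => B) := ⟨B, fun _ _ => (abs_of_nonneg hC0).le⟩
  set S : Set (Fin M → E d → ℝ) :=
    {u | IsSubsolution (Fpen P Q ρ) u ∧ ∀ i x, |u i x| ≤ B} with hS
  have hmem : (fun _ _ => -B) ∈ S := ⟨hsub, fun _ _ => by rw [abs_neg, abs_of_nonneg hC0]⟩
  set w : Fin M → E d → ℝ := fun i x => sSup ((fun u => u i x) '' S) with hw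
  have hne : ∀ i x, ((fun u : Fin M → E d → ℝ => u i x) '' S).Nonempty := fun i x =>
    ⟨_, Set.mem_image_of_mem _ hmem⟩
  have hbd : ∀ i x, ∀ a ∈ (fun u : Fin M → E d → ℝ => u i x) '' S, a ≤ B := by
    rintro i x _ ⟨u, hu, rfl⟩
    exact (abs_le.1 (hu.2 i x)).2
  have hle : ∀ u ∈ S, ∀ i x, u i x ≤ w i x := fun u hu i x =>
    le_csSup ⟨B, hbd i x⟩ (Set.mem_image_of_mem _ hu)
  have hwB : ∀ i x, w i x ≤ B := fun i x => csSup_le (hne i x) (hbd i x)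
  set W : Fin M → E d → ℝ := fun i => uscEnv (w i) with hW
  have hWsub : IsSubsolution (Fpen P Q ρ) W :=
    isSubsolution_uscEnv h1 h2 hρ (fun u hu => hu.1) (fun u hu i x => (abs_le.1 (hu.2 i x)).1)
      hwB hle fun i x c hc => by
        obtain ⟨_, ⟨u, hu, rfl⟩, hlt⟩ := exists_lt_of_lt_csSup (hne i x) hc
        exact ⟨u, hu, hlt⟩
  have hwW : ∀ i x, w i x ≤ W i x := fun i x => le_uscEnv (hwB i) x
  have hWB : ∀ i x, |W i x| ≤ B := fun i x =>
    abs_le.2 ⟨(hle _ hmem i x).trans (hwW i x), uscEnv_le (hwB i) x⟩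
  have hmax : ∀ U, Bdd U → IsSubsolution (Fpen P Q ρ) U → (∀ i x, W i x ≤ U i x) →
      ∀ i x, U i x ≤ W i x := fun U hUB hU hWU i x => by
    have hUS : U ∈ S := ⟨hU, fun j y => abs_le.2 ⟨(abs_le.1 (hWB j y)).1.trans (hWU j y),
      comparison h1 h2 hρ hUB hbB hU hsup j y⟩⟩
    exact (hle U hUS i x).trans (hwW i x)
  have hV := isSupersolution_lscEnv h1 h2 hρ hWsub hWB hmax
  set V : Fin M → E d → ℝ := fun i x => -uscEnv (fun y => -W i y) x with hVdef
  have hnegB : ∀ i y, -W i y ≤ B := fun i y => by linarith [(abs_le.1 (hWB i y)).1]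
  have hVW : ∀ i x, V i x ≤ W i x := fun i x => by
    have := le_uscEnv (hnegB i) x
    simp only [hVdef]
    linarith
  have hVB : ∀ i x, |V i x| ≤ B := fun i x =>
    abs_le.2 ⟨neg_le_neg (uscEnv_le (hnegB i) x), (hVW i x).trans (abs_le.1 (hWB i x)).2⟩
  have hWV : W = V := funext₂ fun i x =>
    le_antisymm (comparison h1 h2 hρ ⟨B, hWB⟩ ⟨B, hVB⟩ hWsub hV i x) (hVW i x)
  rw [← hWV] at hV
  exact ⟨W, ⟨fun i => continuous_iff_lower_upperSemicontinuous.2 ⟨hV.1 i, hWsub.1 i⟩,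
    hWsub, hV⟩, hWB⟩

end Perron

/-- Comparison principle and well-posedness for the penalized system:
under (H.1) and (H.2), for every fixed penalty parameter `ρ ≥ 0`, bounded subsolutions lie
below bounded supersolutions; consequently there is a unique bounded viscosity solution,
whose sup-norm is bounded by a constant independent of `ρ`. -/
theorem comparison_wellposedness_penalized
    {d d' M : ℕ} {𝒜 𝒵 : Type} [MetricSpace 𝒜] [MetricSpace 𝒵]
    (P : HJBData d d' M 𝒜) (Q : ImpulseData d M 𝒵) (C lam0 κ₀ : ℝ)
    (h1 : H1 P C lam0) (h2 : H2 Q κ₀) :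
    (∀ ρ : ℝ, 0 ≤ ρ → ∀ u v : Fin M → E d → ℝ, Bdd u → Bdd v →
      IsSubsolution (Fpen P Q ρ) u → IsSupersolution (Fpen P Q ρ) v →
      ∀ i x, u i x ≤ v i x) ∧
    ∃ C' : ℝ, ∀ ρ : ℝ, 0 ≤ ρ → ∃ w : Fin M → E d → ℝ,
      Bdd w ∧ IsSolution (Fpen P Q ρ) w ∧ (∀ i x, |w i x| ≤ C') ∧
      ∀ w' : Fin M → E d → ℝ, Bdd w' → IsSolution (Fpen P Q ρ) w' → w' = w := by
  refine ⟨fun ρ hρ u v hbu hbv hu hv i x => comparison h1 h2 hρ hbu hbv hu hv i x,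
    |C| / lam0, fun ρ hρ => ?_⟩
  obtain ⟨w, hw, hwB⟩ := exists_isSolution h1 h2 hρ
  have hbw : Bdd w := ⟨_, hwB⟩
  exact ⟨w, hbw, hw, hwB, fun w' hb' hw' => funext₂ fun i x =>
    le_antisymm (comparison h1 h2 hρ hb' hbw hw'.2.1 hw.2.2 i x)
      (comparison h1 h2 hρ hbw hb' hw.2.1 hw'.2.2 i x)⟩
end HJBQVI
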